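/- Let T be a complete arithmetically definable theory in a countable arithmetically definable language with no finite models, and assume T is arithmetically stable. Then there exists an arithmetically decidable model P ⊨ T which is prime. -/

import Mathlib

open FirstOrder FirstOrder.Language

namespace ArMorley

/-! ## Arithmetical sets and arithmetic reducibility -/

/-- Function symbols of the language of arithmetic: `0`, `1`, `+`, `·`. -/
inductive ArFunc : ℕ → Type
  | zero : ArFunc 0
  | one : ArFunc 0
  | add : ArFunc 2
  | mul : ArFunc 2

/-- Relation symbols: `<` and a unary oracle predicate. -/
inductive ArRel : ℕ → Type
  | lt : ArRel 2
  | mem : ArRel 1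

/-- The language `(+, ·, 0, 1, <, Y)` of arithmetic with a unary oracle predicate. -/
def arithLang : FirstOrder.Language := ⟨ArFunc, ArRel⟩

/-- The standard structure on `ℕ`, with the oracle predicate interpreted by `Y`. -/
def arithStructure (Y : Set ℕ) : arithLang.Structure ℕ where
  funMap := fun {n} f =>
    match f with
    | ArFunc.zero => fun _ => 0
    | ArFunc.one => fun _ => 1
    | ArFunc.add => fun v => v 0 + v 1
    | ArFunc.mul => fun v => v 0 * v 1
  RelMap := fun {n} r =>
    match r with
    | ArRel.lt => fun v => v 0 < v 1
    | ArRel.mem => fun v => v 0 ∈ Y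

/-- `X ≤_ar Y` : `X` is definable without parameters in `(ℕ, +, ·, 0, 1, <, Y)`. -/
def ArReducible (X Y : Set ℕ) : Prop :=
  letI := arithStructure Y
  ∃ φ : arithLang.Formula (Fin 1), X = { n : ℕ | φ.Realize (fun _ => n) }

/-- `X` is arithmetical: definable without parameters in `(ℕ, +, ·, 0, 1, <)`. -/
def IsArithmetical (X : Set ℕ) : Prop := ArReducible X ∅

/-- `X` and `Y` have the same arithmetic degree. -/
def ArEquiv (X Y : Set ℕ) : Prop := ArReducible X Y ∧ ArReducible Y X

/-! ## Coding conventions -/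

/-- Code of a list of naturals. -/
def listCode (l : List ℕ) : ℕ := Encodable.encode l

/-- Code of a finite tuple of naturals. -/
def tupleCode {n : ℕ} (v : Fin n → ℕ) : ℕ := listCode (List.ofFn v)

/-- The subset of `ℕ` corresponding to a set of elements of a coded domain. -/
def subCode {A : Set ℕ} (S : Set ↥A) : Set ℕ := Subtype.val '' S

/-- Code of a set of `n`-tuples from a coded domain as a subset of `ℕ`. -/
def tupleSetCode {A : Set ℕ} {n : ℕ} (X : Set (Fin n → ↥A)) : Set ℕ :=
  { c : ℕ | ∃ v ∈ X, c = tupleCode (fun i => ((v i : ℕ))) }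

/-- Code of the graph of a function between coded domains. -/
def graphCode {A B : Set ℕ} (f : ↥A → ↥B) : Set ℕ :=
  { c : ℕ | ∃ a : ↥A, c = Nat.pair (a : ℕ) ((f a : ℕ)) }

/-! ## Gödel coded languages -/

/-- A fixed Gödel coding of the symbols of a countable first-order language. -/
structure GoedelCoding (L : FirstOrder.Language) where
  encFun : ∀ n, L.Functions n → ℕ
  encFun_inj : ∀ n, Function.Injective (encFun n)
  encRel : ∀ n, L.Relations n → ℕ
  encRel_inj : ∀ n, Function.Injective (encRel n)

variable {L : FirstOrder.Language}

/-- The set of codes of the symbols of `L`. -/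
def symbolCodes (g : GoedelCoding L) : Set ℕ :=
  { c | (∃ (n : ℕ) (f : L.Functions n), c = Nat.pair 0 (Nat.pair n (g.encFun n f))) ∨
        (∃ (n : ℕ) (R : L.Relations n), c = Nat.pair 1 (Nat.pair n (g.encRel n R))) }

/-- `L` is an arithmetically definable language. -/
def ArithLang (g : GoedelCoding L) : Prop := IsArithmetical (symbolCodes g)

/-- Code of a term, with a given coding of the variables. -/
def termCode (g : GoedelCoding L) {α : Type} (encα : α → ℕ) (t : L.Term α) : ℕ :=
  listCode (t.listEncode.map (Sum.elim (fun a => Nat.pair 0 (encα a))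
    (fun p => Nat.pair 1 (Nat.pair p.1 (g.encFun p.1 p.2)))))

/-- Code of a (bounded) formula, with a given coding of free variables. -/
def formulaCode (g : GoedelCoding L) {α : Type} (encα : α → ℕ) {n : ℕ}
    (φ : L.BoundedFormula α n) : ℕ :=
  listCode (φ.listEncode.map (Sum.elim
    (fun p => Nat.pair 0 (Nat.pair p.1
      (termCode g (Sum.elim (fun a => Nat.pair 0 (encα a)) (fun i => Nat.pair 1 i.1)) p.2)))
    (Sum.elim
      (fun q => Nat.pair 1 (Nat.pair q.1 (g.encRel q.1 q.2)))
      (fun m => Nat.pair 2 m))))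

/-- Code of a sentence. -/
def sentenceCode (g : GoedelCoding L) (φ : L.Sentence) : ℕ :=
  formulaCode g (fun a : Empty => a.elim) φ

/-- The set of codes of the axioms of a theory. -/
def theoryCode (g : GoedelCoding L) (T : L.Theory) : Set ℕ :=
  { c | ∃ φ ∈ T, c = sentenceCode g φ }

/-- `T` is an arithmetically definable theory. -/
def ArithTheory (g : GoedelCoding L) (T : L.Theory) : Prop := IsArithmetical (theoryCode g T)

/-! ## Coded structures -/

/-- A coded `L`-structure: an `L`-structure whose domain is a subset of `ℕ`
with infinite complement. -/
structure CodedStructure (L : FirstOrder.Language) where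
  carrier : Set ℕ
  compl_infinite : (carrierᶜ : Set ℕ).Infinite
  struc : L.Structure ↥carrier

/-- A coded structure is a model of `T`. -/
def CodedStructure.Models (M : CodedStructure L) (T : L.Theory) : Prop :=
  ∀ φ ∈ T, @Sentence.Realize L ↥M.carrier M.struc φ

/-- The (coded) elementary diagram of a coded structure. -/
def elemDiagram (g : GoedelCoding L) (M : CodedStructure L) : Set ℕ :=
  { c | ∃ (k : ℕ) (φ : L.Formula (Fin k)) (a : Fin k → ↥M.carrier),
      c = Nat.pair (Nat.pair k (formulaCode g Fin.val φ)) (tupleCode fun i => ((a i : ℕ))) ∧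
      (letI := M.struc; φ.Realize a) }

/-- A coded structure is arithmetically decidable if its elementary diagram is arithmetical. -/
def ArithDecidable (g : GoedelCoding L) (M : CodedStructure L) : Prop :=
  IsArithmetical (elemDiagram g M)

/-- `M ≼ N` for coded structures: `M`'s domain is contained in `N`'s, and the
inclusion is elementary. -/
structure ElemSub (M N : CodedStructure L) : Prop where
  subset : M.carrier ⊆ N.carrier
  elem : ∀ (k : ℕ) (φ : L.Formula (Fin k)) (a : Fin k → ↥M.carrier),
    (letI := M.struc; φ.Realize a) ↔
      (letI := N.struc; φ.Realize (fun i => (⟨((a i : ℕ)), subset (a i).2⟩ : ↥N.carrier)))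

/-- A coded model of `T` is arithmetically extendible if it is an elementary substructure of
an arithmetically decidable coded model of `T`. -/
def ArithExtendible (g : GoedelCoding L) (T : L.Theory) (M : CodedStructure L) : Prop :=
  ∃ N : CodedStructure L, ArithDecidable g N ∧ N.Models T ∧ ElemSub M N

/-! ## Model-theoretic notions in arbitrary structures -/

/-- `N` (with structure `SN`) is a model of `T`. -/
def ModelsT (L : FirstOrder.Language) (T : L.Theory) (N : Type) (SN : L.Structure N) : Prop :=
  ∀ φ ∈ T, @Sentence.Realize L N SN φ

/-- `T` has no finite models. -/
def NoFiniteModels (L : FirstOrder.Language) (T : L.Theory) : Prop :=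
  ∀ (N : Type) (SN : L.Structure N), ModelsT L T N SN → Infinite N

/-- Elementary embeddings, with the structures given explicitly. -/
def EEmb (L : FirstOrder.Language) (M : Type) (SM : L.Structure M)
    (N : Type) (SN : L.Structure N) : Type _ :=
  @FirstOrder.Language.ElementaryEmbedding L M N SM SN

/-- The underlying map of an elementary embedding. -/
def EEmb.fn {L : FirstOrder.Language} {M : Type} {SM : L.Structure M}
    {N : Type} {SN : L.Structure N} (j : EEmb L M SM N SN) : M → N :=
  @FirstOrder.Language.ElementaryEmbedding.toFun L M N SM SN j

/-- A subset of `N^n` definable with parameters from `P`. -/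
def DefinableOverT (L : FirstOrder.Language) (N : Type) (SN : L.Structure N) (P : Set N)
    {n : ℕ} (X : Set (Fin n → N)) : Prop :=
  letI := SN
  ∃ (m : ℕ) (ψ : L.Formula (Fin n ⊕ Fin m)) (b : Fin m → N),
    (∀ i, b i ∈ P) ∧ X = { v | ψ.Realize (Sum.elim v b) }

/-- A subset of `N` definable with (arbitrary) parameters. -/
def Definable1 (L : FirstOrder.Language) (N : Type) (SN : L.Structure N) (Y : Set N) : Prop :=
  letI := SN
  ∃ (m : ℕ) (ψ : L.Formula (Fin 1 ⊕ Fin m)) (b : Fin m → N),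
    Y = { x : N | ψ.Realize (Sum.elim (fun _ => x) b) }

/-- The algebraic closure of `B` in `N`: elements satisfying a formula with parameters
from `B` having finitely many solutions. -/
def aclIn (L : FirstOrder.Language) (N : Type) (SN : L.Structure N) (B : Set N) : Set N :=
  letI := SN
  { a : N | ∃ (k : ℕ) (φ : L.Formula (Fin 1 ⊕ Fin k)) (b : Fin k → N),
      (∀ i, b i ∈ B) ∧ φ.Realize (Sum.elim (fun _ => a) b) ∧
      { x : N | φ.Realize (Sum.elim (fun _ => x) b) }.Finite }

/-- The domain of the substructure of `N` generated by `B`: values of terms at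
arguments from `B`. -/
def genSub (L : FirstOrder.Language) (N : Type) (SN : L.Structure N) (B : Set N) : Set N :=
  letI := SN
  { a : N | ∃ (t : L.Term ℕ) (v : ℕ → N), (∀ i, v i ∈ B) ∧ a = t.realize v }

/-- The set defined by a formula `φ(x, p̄)` in one free variable with parameters `p̄`. -/
def smSet (L : FirstOrder.Language) (N : Type) (SN : L.Structure N) {k : ℕ}
    (φ : L.Formula (Fin 1 ⊕ Fin k)) (p : Fin k → N) : Set N :=
  letI := SN
  { x : N | φ.Realize (Sum.elim (fun _ => x) p) }

/-- A definable tuple-set in a coded structure, with parameters from `P`. -/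
def DefinableOver (M : CodedStructure L) (P : Set ↥M.carrier) {n : ℕ}
    (X : Set (Fin n → ↥M.carrier)) : Prop :=
  DefinableOverT L ↥M.carrier M.struc P X

/-- A definable tuple-set in a coded structure, with arbitrary parameters. -/
def DefinableIn (M : CodedStructure L) {n : ℕ} (X : Set (Fin n → ↥M.carrier)) : Prop :=
  DefinableOver M Set.univ X

/-! ## Isomorphisms of coded structures and `D`-categoricity -/

/-- An isomorphism of coded `L`-structures. -/
structure CodedIso (M N : CodedStructure L) where
  toFun : ↥M.carrier → ↥N.carrier
  invFun : ↥N.carrier → ↥M.carrier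
  left_inv : Function.LeftInverse invFun toFun
  right_inv : Function.RightInverse invFun toFun
  map_fun : ∀ {k : ℕ} (f : L.Functions k) (v : Fin k → ↥M.carrier),
    toFun (M.struc.funMap f v) = N.struc.funMap f (toFun ∘ v)
  map_rel : ∀ {k : ℕ} (r : L.Relations k) (v : Fin k → ↥M.carrier),
    M.struc.RelMap r v ↔ N.struc.RelMap r (toFun ∘ v)

/-- `f` is a `D`-preserving isomorphism, where `d` is a representative of the
arithmetic degree `D`. -/
def DPreserving (d : Set ℕ) {M N : CodedStructure L} (f : CodedIso M N) : Prop :=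
  ArReducible (graphCode f.toFun) d ∧
  ArReducible (graphCode f.invFun) d ∧
  (∀ (n : ℕ) (X : Set (Fin n → ↥M.carrier)), DefinableIn M X →
      ArEquiv (tupleSetCode X) d →
      ArEquiv (tupleSetCode ((fun v => f.toFun ∘ v) '' X)) d) ∧
  (∀ (n : ℕ) (Y : Set (Fin n → ↥N.carrier)), DefinableIn N Y →
      ArEquiv (tupleSetCode Y) d →
      ArEquiv (tupleSetCode ((fun v => f.invFun ∘ v) '' Y)) d)

/-- `T` is `D`-categorical, where `d` is a representative of the nonzero
arithmetic degree `D`. -/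
def DCategorical (g : GoedelCoding L) (T : L.Theory) (d : Set ℕ) : Prop :=
  ∀ M₀ M₁ M₂ : CodedStructure L,
    ArithDecidable g M₀ → M₀.Models T →
    M₁.Models T → ArithExtendible g T M₁ →
    M₂.Models T → ArithExtendible g T M₂ →
    ElemSub M₀ M₁ → ElemSub M₀ M₂ →
    ArEquiv M₁.carrier d → ArEquiv M₂.carrier d →
    ∃ f : CodedIso M₁ M₂, DPreserving d f ∧
      ∀ (x : ℕ) (hx : x ∈ M₀.carrier) (h₁ : x ∈ M₁.carrier),
        ((f.toFun ⟨x, h₁⟩ : ℕ)) = x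

/-! ## Vaughtian pairs, prime models, strong minimality -/

/-- `T` has a Vaughtian pair. -/
def HasVaughtianPair (T : L.Theory) : Prop :=
  ∃ (N : Type) (SN : L.Structure N),
    ModelsT L T N SN ∧
    ∃ S : @FirstOrder.Language.ElementarySubstructure L N SN,
      ((S.toSubstructure : Set N) ≠ Set.univ ∧
      ∃ (k : ℕ) (φ : L.Formula (Fin 1 ⊕ Fin k)) (a : Fin k → N),
        (∀ i, a i ∈ (S.toSubstructure : Set N)) ∧
        smSet L N SN φ a ⊆ (S.toSubstructure : Set N) ∧
        (smSet L N SN φ a).Infinite)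

/-- A coded model of `T` is prime: it elementarily embeds into every model of `T`. -/
def PrimeModel (L : FirstOrder.Language) (T : L.Theory) (P : CodedStructure L) : Prop :=
  P.Models T ∧ ∀ (N : Type) (SN : L.Structure N), ModelsT L T N SN →
    Nonempty (EEmb L ↥P.carrier P.struc N SN)

/-- `φ(x, p̄)` is strongly minimal over the coded model `M`: its solution set in `M` is
infinite, and in every elementary extension of `M` modelling `T` every definable subset of
its solution set is finite or cofinite in it. -/
def StronglyMinimalOver (T : L.Theory) (M : CodedStructure L) {k : ℕ}
    (φ : L.Formula (Fin 1 ⊕ Fin k)) (p : Fin k → ↥M.carrier) : Prop :=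
  (smSet L ↥M.carrier M.struc φ p).Infinite ∧
  ∀ (N : Type) (SN : L.Structure N), ModelsT L T N SN →
    ∀ j : EEmb L ↥M.carrier M.struc N SN,
      ∀ Y : Set N, Definable1 L N SN Y →
        Y ⊆ smSet L N SN φ (fun i => j.fn (p i)) →
        (Y.Finite ∨ ((smSet L N SN φ (fun i => j.fn (p i))) \ Y).Finite)

/-- `T` is a strongly minimal theory: every model is infinite, and every
parameter-definable subset of any model is finite or cofinite. -/
def StronglyMinimalTheory (L : FirstOrder.Language) (T : L.Theory) : Prop :=
  (∀ (N : Type) (SN : L.Structure N), ModelsT L T N SN → Infinite N) ∧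
  (∀ (N : Type) (SN : L.Structure N), ModelsT L T N SN →
    ∀ Y : Set N, Definable1 L N SN Y → (Y.Finite ∨ (Yᶜ : Set N).Finite))

/-- The structural control clause: an arithmetically decidable prime model together with
a strongly minimal formula over it generating every elementary extension. -/
def GeneratesAll (T : L.Theory) (P : CodedStructure L) {k : ℕ}
    (φ : L.Formula (Fin 1 ⊕ Fin k)) (p : Fin k → ↥P.carrier) : Prop :=
  ∀ (N : Type) (SN : L.Structure N), ModelsT L T N SN →
    ∀ j : EEmb L ↥P.carrier P.struc N SN,
      aclIn L N SN (Set.range j.fn ∪ smSet L N SN φ (fun i => j.fn (p i))) = Set.univ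

/-- Clause (3) of the arithmetic Baldwin–Lachlan theorem. -/
def SMControl (g : GoedelCoding L) (T : L.Theory) : Prop :=
  ∃ (P : CodedStructure L), ArithDecidable g P ∧ PrimeModel L T P ∧
    ∃ (k : ℕ) (φ : L.Formula (Fin 1 ⊕ Fin k)) (p : Fin k → ↥P.carrier),
      StronglyMinimalOver T P φ p ∧ GeneratesAll T P φ p

/-! ## Types and arithmetical stability -/

/-- A formula with a finite parameter tuple from a coded structure, in `n` object
variables. -/
def ParamFormula (L : FirstOrder.Language) (M : CodedStructure L) (n : ℕ) : Type :=
  Σ k : ℕ, L.Formula (Fin n ⊕ Fin k) × (Fin k → ↥M.carrier)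

/-- All parameters of `q` lie in `A`. -/
def paramsIn {M : CodedStructure L} {n : ℕ} (A : Set ℕ) (q : ParamFormula L M n) : Prop :=
  ∀ i, ((q.2.2 i : ℕ)) ∈ A

/-- `p` is consistent with the elementary diagram of `M`: it is realized in some
elementary extension of `M`. -/
def TypeConsistent (M : CodedStructure L) {n : ℕ} (p : Set (ParamFormula L M n)) : Prop :=
  ∃ (N : Type) (SN : L.Structure N) (j : EEmb L ↥M.carrier M.struc N SN) (b : Fin n → N),
    ∀ q ∈ p, letI := SN; q.2.1.Realize (Sum.elim b (fun i => j.fn (q.2.2 i)))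

/-- `p` is a (complete) `n`-type over `A` inside `M`: a maximal set of formulas with
parameters from `A` consistent with the elementary diagram of `M`. -/
def IsNType (M : CodedStructure L) (A : Set ℕ) (n : ℕ)
    (p : Set (ParamFormula L M n)) : Prop :=
  (∀ q ∈ p, paramsIn A q) ∧
  TypeConsistent M p ∧
  ∀ q : ParamFormula L M n, paramsIn A q → q ∉ p → ¬ TypeConsistent M (insert q p)

/-- The code of a formula-with-parameters. -/
def pfCode (g : GoedelCoding L) {M : CodedStructure L} {n : ℕ} (q : ParamFormula L M n) : ℕ :=
  Nat.pair
    (Nat.pair q.1 (formulaCode g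
      (Sum.elim (fun i : Fin n => Nat.pair 0 i.1) (fun j : Fin q.1 => Nat.pair 1 j.1)) q.2.1))
    (tupleCode fun i => ((q.2.2 i : ℕ)))

/-- The set of codes of the formulas of `p`. -/
def typeCode (g : GoedelCoding L) {M : CodedStructure L} {n : ℕ}
    (p : Set (ParamFormula L M n)) : Set ℕ :=
  { c | ∃ q ∈ p, c = pfCode g q }

/-- `p` is realized in the coded elementary extension `N` of `M`. -/
def RealizesType {M N : CodedStructure L} (h : M.carrier ⊆ N.carrier) {n : ℕ}
    (p : Set (ParamFormula L M n)) : Prop :=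
  ∃ b : Fin n → ↥N.carrier, ∀ q ∈ p,
    letI := N.struc
    q.2.1.Realize (Sum.elim b (fun i => (⟨((q.2.2 i : ℕ)), h (q.2.2 i).2⟩ : ↥N.carrier)))

/-- The `(n, i)`-th column of an effective join. -/
def tripleSection (X : Set ℕ) (n i : ℕ) : Set ℕ := { m | Nat.pair n (Nat.pair i m) ∈ X }

/-- `T` is arithmetically stable: over every arithmetically decidable model and every
arithmetical parameter set, the family of arithmetic `n`-types (for all `n ≥ 1`) has a
uniform arithmetical code in which every arithmetic `n`-type appears at least once. -/
def ArithStable (g : GoedelCoding L) (T : L.Theory) : Prop :=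
  ∀ M : CodedStructure L, ArithDecidable g M → M.Models T →
    ∀ A : Set ℕ, A ⊆ M.carrier → IsArithmetical A →
      ∃ X : Set ℕ, IsArithmetical X ∧
        (∀ n, 1 ≤ n → ∀ i : ℕ, ∃ p : Set (ParamFormula L M n),
            IsNType M A n p ∧ IsArithmetical (typeCode g p) ∧
            tripleSection X n i = typeCode g p) ∧
        (∀ n, 1 ≤ n → ∀ p : Set (ParamFormula L M n),
            IsNType M A n p → IsArithmetical (typeCode g p) →
            ∃ i : ℕ, tripleSection X n i = typeCode g p)

/-- The set of elements occurring as a coordinate of a tuple in `X`. -/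
def coordSet {N : Type} {n : ℕ} (X : Set (Fin n → N)) : Set N :=
  { m | ∃ v ∈ X, ∃ i, v i = m }


/-! ## Definability in the standard model of arithmetic -/

section Definability


/-- The standard structure on `ℕ`, with empty oracle. -/
@[reducible] def stdStructure : arithLang.Structure ℕ := arithStructure ∅

attribute [local instance] stdStructure

/-- Definability of a predicate on tuples of naturals. -/
def DefPred {α : Type} (p : (α → ℕ) → Prop) : Prop :=
  (∅ : Set ℕ).Definable arithLang {v : α → ℕ | p v}

/-- Definability of a function on tuples of naturals. -/
def DefFun {α : Type} (f : (α → ℕ) → ℕ) : Prop :=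
  (∅ : Set ℕ).DefinableFun arithLang f

variable {α β : Type} {p q : (α → ℕ) → Prop} {f g : (α → ℕ) → ℕ}

theorem DefPred.and (hp : DefPred p) (hq : DefPred q) : DefPred fun v => p v ∧ q v :=
  Set.Definable.inter hp hq

theorem DefPred.or (hp : DefPred p) (hq : DefPred q) : DefPred fun v => p v ∨ q v :=
  Set.Definable.union hp hq

theorem DefPred.not (hp : DefPred p) : DefPred fun v => ¬ p v :=
  Set.Definable.compl hp

theorem DefPred.imp (hp : DefPred p) (hq : DefPred q) : DefPred fun v => p v → q v := by
  simpa only [imp_iff_not_or] using hp.not.or hq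

theorem DefPred.ex {r : (α → ℕ) → ℕ → Prop}
    (h : DefPred fun w : α ⊕ Unit → ℕ => r (w ∘ Sum.inl) (w (Sum.inr ()))) :
    DefPred fun v => ∃ x, r v x := by
  have := Set.Definable.exists_of_finite (A := (∅ : Set ℕ)) (L := arithLang) h
  refine Eq.mp (congrArg _ ?_) this
  ext v
  constructor
  · rintro ⟨u, hu⟩
    exact ⟨u (), hu⟩
  · rintro ⟨x, hx⟩
    exact ⟨fun _ => x, hx⟩

theorem DefPred.all {r : (α → ℕ) → ℕ → Prop}
    (h : DefPred fun w : α ⊕ Unit → ℕ => r (w ∘ Sum.inl) (w (Sum.inr ()))) :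
    DefPred fun v => ∀ x, r v x := by
  simpa using (DefPred.ex (r := fun v x => ¬ r v x) h.not).not

theorem DefPred.subst [Finite β] {r : (β → ℕ) → Prop} (hr : DefPred r) {F : β → (α → ℕ) → ℕ}
    (hF : ∀ b, DefFun (F b)) : DefPred fun v => r fun b => F b v :=
  Set.Definable.preimage_map (F := fun v b => F b v) hF hr

theorem DefFun.subst [Finite β] {r : (β → ℕ) → ℕ} (hr : DefFun r) {F : β → (α → ℕ) → ℕ}
    (hF : ∀ b, DefFun (F b)) : DefFun fun v => r fun b => F b v :=
  Set.DefinableFun.comp (g := fun v b => F b v) hF hr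

theorem DefFun.var (i : α) : DefFun fun v => v i := Set.DefinableFun.proj arithLang

theorem DefPred.eq (hf : DefFun f) (hg : DefFun g) : DefPred fun v => f v = g v :=
  Set.DefinableFun.ofPred_eq hf hg

theorem DefFun.comp_inl (hf : DefFun f) : DefFun fun w : α ⊕ β → ℕ => f (w ∘ Sum.inl) := by
  have := Set.Definable.preimage_comp
    (fun | none => none | some i => some (Sum.inl i) : Option α → Option (α ⊕ β)) hf
  exact this

theorem DefFun.ofGraph (h : DefPred fun w : α ⊕ Unit → ℕ => w (Sum.inr ()) = f (w ∘ Sum.inl)) :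
    DefFun f := by
  have := Set.Definable.preimage_comp
    (fun | Sum.inl i => some i | Sum.inr _ => none : α ⊕ Unit → Option α) h
  unfold DefFun Set.DefinableFun
  convert this using 1
  ext v
  exact eq_comm

theorem DefFun.add (hf : DefFun f) (hg : DefFun g) : DefFun fun v => f v + g v := by
  have : DefFun fun v : Fin 2 → ℕ => v 0 + v 1 :=
    Set.DefinableFun.fun_symbol (L := arithLang) ArFunc.add
  exact this.subst (F := ![f, g]) (by simp [Fin.forall_fin_two, hf, hg])

theorem DefFun.mul (hf : DefFun f) (hg : DefFun g) : DefFun fun v => f v * g v := by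
  have : DefFun fun v : Fin 2 → ℕ => v 0 * v 1 :=
    Set.DefinableFun.fun_symbol (L := arithLang) ArFunc.mul
  exact this.subst (F := ![f, g]) (by simp [Fin.forall_fin_two, hf, hg])

theorem DefFun.const (n : ℕ) : DefFun fun _ : α → ℕ => n := by
  induction n with
  | zero =>
    have : DefFun fun _ : Fin 0 → ℕ => 0 :=
      Set.DefinableFun.fun_symbol (L := arithLang) ArFunc.zero
    exact this.subst (F := Fin.elim0) (fun b => b.elim0)
  | succ n ih =>
    have : DefFun fun _ : Fin 0 → ℕ => 1 :=
      Set.DefinableFun.fun_symbol (L := arithLang) ArFunc.one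
    exact ih.add (this.subst (F := Fin.elim0) (fun b => b.elim0))

theorem DefPred.lt (hf : DefFun f) (hg : DefFun g) : DefPred fun v => f v < g v := by
  have : DefPred fun v => ∃ x, f v + x + 1 = g v :=
    .ex (.eq ((hf.comp_inl.add (.var _)).add (.const 1)) hg.comp_inl)
  convert this using 2 with v
  exact ⟨fun h => ⟨g v - f v - 1, by omega⟩, fun ⟨x, hx⟩ => by omega⟩

theorem DefFun.pair (hf : DefFun f) (hg : DefFun g) : DefFun fun v => Nat.pair (f v) (g v) := by
  refine .ofGraph ?_
  have hlt := DefPred.lt hf.comp_inl (hg.comp_inl (β := Unit))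
  have h1 := DefPred.eq (.var (Sum.inr ())) (.add (.mul hg.comp_inl hg.comp_inl) hf.comp_inl)
  have h2 := DefPred.eq (.var (Sum.inr ()))
    (.add (.add (.mul hf.comp_inl hf.comp_inl) hf.comp_inl) hg.comp_inl)
  convert (hlt.and h1).or (hlt.not.and h2) using 2 with v
  unfold Nat.pair
  split_ifs with h <;> simp [h]

theorem DefFun.unpair_fst (hf : DefFun f) : DefFun fun v => (Nat.unpair (f v)).1 := by
  refine .ofGraph ?_
  have : DefPred fun w : α ⊕ Unit → ℕ => ∃ y, Nat.pair (w (Sum.inr ())) y = f (w ∘ Sum.inl) :=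
    .ex (.eq (.pair (.var (Sum.inl (Sum.inr ()))) (.var _)) hf.comp_inl.comp_inl)
  convert this using 2 with v
  constructor
  · intro h
    exact ⟨(Nat.unpair (f (v ∘ Sum.inl))).2, by rw [h, Nat.pair_unpair]⟩
  · rintro ⟨y, hy⟩
    rw [← hy, Nat.unpair_pair]

theorem DefFun.unpair_snd (hf : DefFun f) : DefFun fun v => (Nat.unpair (f v)).2 := by
  refine .ofGraph ?_
  have : DefPred fun w : α ⊕ Unit → ℕ => ∃ y, Nat.pair y (w (Sum.inr ())) = f (w ∘ Sum.inl) :=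
    .ex (.eq (.pair (.var _) (.var (Sum.inl (Sum.inr ())))) hf.comp_inl.comp_inl)
  convert this using 2 with v
  constructor
  · intro h
    exact ⟨(Nat.unpair (f (v ∘ Sum.inl))).1, by rw [h, Nat.pair_unpair]⟩
  · rintro ⟨y, hy⟩
    rw [← hy, Nat.unpair_pair]

theorem DefFun.mod (hf : DefFun f) (hg : DefFun g) : DefFun fun v => f v % g v := by
  refine .ofGraph ?_
  have h0 : DefPred fun w : α ⊕ Unit → ℕ => g (w ∘ Sum.inl) = 0 ∧
      w (Sum.inr ()) = f (w ∘ Sum.inl) :=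
    (DefPred.eq hg.comp_inl (.const 0)).and (.eq (.var _) hf.comp_inl)
  have h1 : DefPred fun w : α ⊕ Unit → ℕ => w (Sum.inr ()) < g (w ∘ Sum.inl) ∧
      ∃ k, f (w ∘ Sum.inl) = w (Sum.inr ()) + g (w ∘ Sum.inl) * k :=
    (DefPred.lt (.var _) hg.comp_inl).and <| .ex <| .eq hf.comp_inl.comp_inl <|
      .add (.var (Sum.inl (Sum.inr ()))) (.mul hg.comp_inl.comp_inl (.var _))
  convert h0.or h1 using 2 with v
  constructor
  · intro h
    rcases Nat.eq_zero_or_pos (g (v ∘ Sum.inl)) with h' | h'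
    · left
      simp [h, h']
    · right
      rw [h]
      exact ⟨Nat.mod_lt _ h', _, (Nat.mod_add_div _ _).symm⟩
  · rintro (⟨h, h'⟩ | ⟨h, k, h'⟩)
    · simp [h, h']
    · rw [h', Nat.add_mul_mod_self_left, Nat.mod_eq_of_lt h]

theorem DefFun.beta (hf : DefFun f) (hg : DefFun g) : DefFun fun v => Nat.beta (f v) (g v) :=
  .mod hf.unpair_fst (.add (.mul (.add hg (.const 1)) hf.unpair_snd) (.const 1))

/-- Primitive recursive functions are definable. -/
theorem DefFun.of_primrec {h : ℕ → ℕ} (hh : Nat.Primrec h) (hf : DefFun f) :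
    DefFun fun v => h (f v) := by
  induction hh generalizing α with
  | zero => exact .const 0
  | succ => exact hf.add (.const 1)
  | left => exact hf.unpair_fst
  | right => exact hf.unpair_snd
  | pair _ _ ih₁ ih₂ => exact (ih₁ hf).pair (ih₂ hf)
  | comp _ _ ih₁ ih₂ => exact ih₁ (ih₂ hf)
  | @prec a b ha hb iha ihb =>
    refine .ofGraph ?_
    have hf' := hf.comp_inl (β := Unit)
    have hd : DefPred fun w : α ⊕ Unit → ℕ => ∃ c,
        Nat.beta c 0 = a (Nat.unpair (f (w ∘ Sum.inl))).1 ∧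
        (∀ y, y < (Nat.unpair (f (w ∘ Sum.inl))).2 → Nat.beta c (y + 1) =
          b (Nat.pair (Nat.unpair (f (w ∘ Sum.inl))).1 (Nat.pair y (Nat.beta c y)))) ∧
        w (Sum.inr ()) = Nat.beta c (Nat.unpair (f (w ∘ Sum.inl))).2 := by
      refine .ex (.and (.eq (.beta (.var _) (.const 0)) (iha hf'.comp_inl.unpair_fst)) (.and ?_ ?_))
      · refine .all (.imp (.lt (.var _) hf'.comp_inl.comp_inl.unpair_snd)
          (.eq (.beta (.var (Sum.inl (Sum.inr ()))) (.add (.var _) (.const 1))) (ihb ?_)))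
        exact .pair hf'.comp_inl.comp_inl.unpair_fst
          (.pair (.var _) (.beta (.var (Sum.inl (Sum.inr ()))) (.var _)))
      · exact .eq (.var (Sum.inl (Sum.inr ()))) (.beta (.var _) hf'.comp_inl.unpair_snd)
    convert hd using 2 with v
    set n := f (v ∘ Sum.inl)
    set r : ℕ → ℕ := Nat.rec (a n.unpair.1) fun y IH => b (Nat.pair n.unpair.1 (Nat.pair y IH))
      with hr
    simp only [Nat.unpaired]
    change v (Sum.inr ()) = r n.unpair.2 ↔ _
    constructor
    · intro h
      have hb (i : ℕ) (hi : i < n.unpair.2 + 1) :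
          Nat.beta (Nat.unbeta ((List.range (n.unpair.2 + 1)).map r)) i = r i := by
        have := Nat.beta_unbeta_coe ((List.range (n.unpair.2 + 1)).map r)
          ⟨i, by simpa using hi⟩
        simpa only [Fin.getElem_fin, List.getElem_map, List.getElem_range] using this
      refine ⟨Nat.unbeta ((List.range (n.unpair.2 + 1)).map r), ?_, ?_, ?_⟩
      · rw [hb _ (by omega)]
        rfl
      · intro y hy
        rw [hb _ (by omega), hb _ (by omega)]
      · rw [hb _ (by omega), h]
    · rintro ⟨c, h0, h1, h2⟩
      have : ∀ i ≤ n.unpair.2, Nat.beta c i = r i := by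
        intro i hi
        induction i with
        | zero => exact h0
        | succ i ih => rw [h1 i (by omega), ih (by omega)]
      rw [h2, this _ le_rfl]

theorem isArithmetical_iff {X : Set ℕ} :
    IsArithmetical X ↔ DefPred fun v : Unit → ℕ => v () ∈ X := by
  have h1 : IsArithmetical X ↔ DefPred fun v : Fin 1 → ℕ => v 0 ∈ X := by
    rw [DefPred, Set.empty_definable_iff]
    refine exists_congr fun φ => ?_
    constructor
    · rintro rfl
      ext v
      have : v = fun _ => v 0 := by
        ext i
        rw [Subsingleton.elim i 0]
      conv_rhs => rw [this]
      rfl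
    · intro h
      ext n
      exact Set.ext_iff.1 h fun _ => n
  rw [h1]
  exact ⟨fun h => h.subst (F := fun _ v => v ()) fun _ => .var _,
    fun h => h.subst (F := fun _ v => v 0) fun _ => .var _⟩

end Definability

/-! ## Arithmetical functions and predicates on primcodable types -/

noncomputable instance : Primcodable Prop := Primcodable.ofEquiv Bool Equiv.propEquivBool

section Arith

open Encodable

/-- A function between primcodable types is arithmetical if its action on codes is. -/
@[fun_prop]
def Arith {α β : Type} [Primcodable α] [Primcodable β] (f : α → β) : Prop :=
  DefFun fun v : Unit → ℕ => encode ((decode (α := α) (v ())).map f)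

variable {α β γ δ : Type} [Primcodable α] [Primcodable β] [Primcodable γ] [Primcodable δ]

theorem Primrec.arith {f : α → β} (hf : Primrec f) : Arith f :=
  DefFun.of_primrec hf (.var ())

theorem Primrec₂.arith {f : α → β → γ} (hf : Primrec₂ f) : Arith fun x : α × β => f x.1 x.2 :=
  Primrec.arith hf

@[fun_prop]
theorem Arith.id : Arith fun a : α => a := Primrec.arith Primrec.id

@[fun_prop]
theorem Arith.const (b : β) : Arith fun _ : α => b := Primrec.arith (Primrec.const b)

@[fun_prop]
theorem Arith.comp {g : β → γ} {f : α → β} (hg : Arith g) (hf : Arith f) :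
    Arith fun a => g (f a) := by
  have h1 : DefFun fun v : Unit → ℕ => Nat.pred (encode ((decode (α := α) (v ())).map f)) :=
    DefFun.of_primrec Nat.Primrec.pred hf
  have h2 := DefFun.subst hg (F := fun _ => fun v : Unit → ℕ =>
    Nat.pred (encode ((decode (α := α) (v ())).map f))) (fun _ => h1)
  have hc : Primrec fun p : ℕ × ℕ => if p.1 = 0 then 0 else p.2 :=
    Primrec.ite (PrimrecRel.comp Primrec.eq Primrec.fst (Primrec.const 0))
      (Primrec.const 0) Primrec.snd
  have hc' : Nat.Primrec fun n : ℕ => if n.unpair.1 = 0 then 0 else n.unpair.2 :=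
    Primrec.nat_iff.1 (hc.comp Primrec.unpair)
  refine Eq.mp (congrArg DefFun ?_) (DefFun.of_primrec hc' (DefFun.pair hf h2))
  funext v
  cases h : decode (α := α) (v ()) <;> simp

@[fun_prop]
theorem Arith.pair {f : α → β} {g : α → γ} (hf : Arith f) (hg : Arith g) :
    Arith fun a => (f a, g a) := by
  have hc : Primrec fun p : ℕ × ℕ => if p.1 = 0 then 0 else (Nat.pair p.1.pred p.2.pred + 1) :=
    Primrec.ite (PrimrecRel.comp Primrec.eq Primrec.fst (Primrec.const 0))
      (Primrec.const 0) (Primrec.succ.comp (Primrec₂.natPair.comp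
        (Primrec.pred.comp Primrec.fst) (Primrec.pred.comp Primrec.snd)))
  have hc' : Nat.Primrec fun n : ℕ => if n.unpair.1 = 0 then 0 else
      (Nat.pair n.unpair.1.pred n.unpair.2.pred + 1) :=
    Primrec.nat_iff.1 (hc.comp Primrec.unpair)
  refine Eq.mp (congrArg DefFun ?_) (DefFun.of_primrec hc' (DefFun.pair hf hg))
  funext v
  cases h : decode (α := α) (v ()) <;> simp

@[fun_prop]
theorem Arith.fst : Arith fun x : α × β => x.1 := Primrec.arith Primrec.fst

@[fun_prop]
theorem Arith.snd : Arith fun x : α × β => x.2 := Primrec.arith Primrec.snd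

theorem encode_prop (p : Prop) : (encode p = 1 ↔ p) ∧ (encode p = 0 ↔ ¬ p) := by
  change (encode (Equiv.propEquivBool p) = 1 ↔ _) ∧ (encode (Equiv.propEquivBool p) = 0 ↔ _)
  by_cases h : p <;> simp [h, Equiv.propEquivBool]

theorem encode_prop_congr (p : Prop) [Decidable p] : encode p = if p then 1 else 0 := by
  split_ifs with h
  · rw [(encode_prop p).1.2 h]
  · rw [(encode_prop p).2.2 h]

theorem arith_iff_defPred {p : α → Prop} :
    Arith p ↔ DefPred fun v : Unit → ℕ => ∃ a, encode a = v () ∧ p a := by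
  have henc : DefFun fun v : Unit → ℕ => encode (decode (α := α) (v ())) :=
    DefFun.of_primrec (Primcodable.prim α) (.var ())
  constructor
  · intro h
    have h1 := (DefPred.eq h (.const 2)).and (DefPred.eq henc (.add (.var ()) (.const 1)))
    convert h1 using 2 with v
    constructor
    · rintro ⟨a, ha, hp⟩
      rw [← ha]
      simp [(encode_prop _).1.2 hp]
    · rintro ⟨h1, h2⟩
      cases h : decode (α := α) (v ()) with
      | none => simp [h] at h1
      | some a =>
        simp only [h, Option.map_some, encode_some, Nat.succ_eq_add_one] at h1 h2
        exact ⟨a, by omega, (encode_prop _).1.1 (by omega)⟩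
  · intro h
    refine .ofGraph ?_
    have h0 := (DefPred.eq henc.comp_inl (.const 0)).and
      (DefPred.eq (.var (Sum.inr ())) (.const (α := Unit ⊕ Unit) 0))
    have hR := DefPred.subst h (α := Unit ⊕ Unit)
      (F := fun _ w => Nat.pred (encode (decode (α := α) (w (Sum.inl ())))))
      fun _ => DefFun.of_primrec Nat.Primrec.pred henc.comp_inl
    have h1 := (DefPred.eq henc.comp_inl (.const 0)).not.and
      ((hR.and (DefPred.eq (.var (Sum.inr ())) (.const (α := Unit ⊕ Unit) 2))).or
        (hR.not.and (DefPred.eq (.var (Sum.inr ())) (.const (α := Unit ⊕ Unit) 1))))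
    convert h0.or h1 using 2 with v
    classical
    simp only [Function.comp]
    cases h : decode (α := α) (v (Sum.inl ())) with
    | none => simp
    | some a => by_cases hp : p a <;> simp [hp, encode_prop_congr]

theorem isArithmetical_iff_arith {X : Set ℕ} : IsArithmetical X ↔ Arith fun n => n ∈ X := by
  simp [arith_iff_defPred, isArithmetical_iff]

@[fun_prop]
theorem Arith.not {p : α → Prop} (hp : Arith p) : Arith fun a => ¬ p a := by
  have : Arith Not := Primrec.arith <| (show Primrec fun p : Prop => ¬ p from
    (Primrec.of_equiv_symm (e := Equiv.propEquivBool)).comp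
      (Primrec.not.comp (Primrec.of_equiv (e := Equiv.propEquivBool))) |>.of_eq fun p => by
        simp [Equiv.propEquivBool])
  exact this.comp hp

@[fun_prop]
theorem Arith.and {p q : α → Prop} (hp : Arith p) (hq : Arith q) : Arith fun a => p a ∧ q a := by
  have : Arith fun x : Prop × Prop => x.1 ∧ x.2 := Primrec.arith <|
    (Primrec.of_equiv_symm (e := Equiv.propEquivBool)).comp (Primrec.and.comp
      ((Primrec.of_equiv (e := Equiv.propEquivBool)).comp .fst)
      ((Primrec.of_equiv (e := Equiv.propEquivBool)).comp .snd)) |>.of_eq fun p => by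
        simp [Equiv.propEquivBool]
  exact this.comp (hp.pair hq)

theorem Arith.congr {f f' : α → β} (hf : Arith f) (h : ∀ a, f a = f' a) : Arith f' := by
  rwa [← funext h]

@[fun_prop]
theorem Arith.or {p q : α → Prop} (hp : Arith p) (hq : Arith q) : Arith fun a => p a ∨ q a :=
  (show Arith fun a => ¬ (¬ p a ∧ ¬ q a) by fun_prop).congr fun a => by rw [← not_or, not_not]

@[fun_prop]
theorem Arith.imp {p q : α → Prop} (hp : Arith p) (hq : Arith q) : Arith fun a => p a → q a :=
  (show Arith fun a => ¬ p a ∨ q a by fun_prop).congr fun a => by rw [imp_iff_not_or]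

@[fun_prop]
theorem Arith.iff {p q : α → Prop} (hp : Arith p) (hq : Arith q) : Arith fun a => p a ↔ q a :=
  (show Arith fun a => (p a → q a) ∧ (q a → p a) from .and (.imp hp hq) (.imp hq hp)).congr
    fun a => by rw [iff_iff_implies_and_implies]

@[fun_prop]
theorem Arith.exists {p : α → β → Prop} (hp : Arith fun x : α × β => p x.1 x.2) :
    Arith fun a => ∃ b, p a b := by
  rw [arith_iff_defPred] at hp ⊢
  have := DefPred.ex (α := Unit) (r := fun v m => ∃ x : α × β, encode x = Nat.pair (v ()) m ∧
    p x.1 x.2) (hp.subst (F := fun _ w => Nat.pair (w (Sum.inl ())) (w (Sum.inr ())))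
      fun _ => .pair (.var _) (.var _))
  convert this using 2 with v
  constructor
  · rintro ⟨a, ha, b, hb⟩
    exact ⟨encode b, (a, b), by simp [ha], hb⟩
  · rintro ⟨m, ⟨a, b⟩, h, hp⟩
    simp only [encode_prod_val, Nat.pair_eq_pair] at h
    exact ⟨a, h.1, b, hp⟩

@[fun_prop]
theorem Arith.forall {p : α → β → Prop} (hp : Arith fun x : α × β => p x.1 x.2) :
    Arith fun a => ∀ b, p a b :=
  (show Arith fun a => ¬ ∃ b, ¬ p a b by fun_prop).congr fun a => by simp

@[fun_prop]
theorem Arith.eq {f g : α → β} (hf : Arith f) (hg : Arith g) : Arith fun a => f a = g a := by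
  classical
  have h : PrimrecRel (@Eq β) := by
    have := Primcodable.prim β
    exact (Primrec.eq.comp (Primrec.encode.comp Primrec.fst)
      (Primrec.encode.comp Primrec.snd)).of_eq fun x => by simp
  obtain ⟨_, h⟩ := h
  have h' : Arith fun x : β × β => x.1 = x.2 :=
    Primrec.arith (((Primrec.of_equiv_symm (e := Equiv.propEquivBool)).comp h).of_eq fun x => by
      simp [Equiv.propEquivBool])
  exact h'.comp (hf.pair hg)

theorem Arith.of_primrecRel {r : α → β → Prop} (h : PrimrecRel r) :
    Arith fun x : α × β => r x.1 x.2 := by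
  obtain ⟨_, h⟩ := h
  exact Primrec.arith (((Primrec.of_equiv_symm (e := Equiv.propEquivBool)).comp h).of_eq fun x => by
      simp [Equiv.propEquivBool])

theorem Arith.of_graph {f : α → β} (h : Arith fun x : α × β => f x.1 = x.2) : Arith f := by
  rw [arith_iff_defPred] at h
  have henc : DefFun fun v : Unit → ℕ => encode (decode (α := α) (v ())) :=
    DefFun.of_primrec (Primcodable.prim α) (.var ())
  refine .ofGraph ?_
  have h0 := (DefPred.eq henc.comp_inl (.const 0)).and
    (DefPred.eq (.var (Sum.inr ())) (.const (α := Unit ⊕ Unit) 0))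
  have hv : DefFun fun v : Unit ⊕ Unit → ℕ => Nat.pred (v (Sum.inr ())) :=
    DefFun.of_primrec Nat.Primrec.pred (.var _)
  have hR := DefPred.subst h (α := Unit ⊕ Unit)
    (F := fun _ w => Nat.pair (Nat.pred (encode (decode (α := α) (w (Sum.inl ())))))
      (Nat.pred (w (Sum.inr ()))))
    fun _ => .pair (DefFun.of_primrec Nat.Primrec.pred henc.comp_inl) hv
  have h1 := (DefPred.eq henc.comp_inl (.const 0)).not.and
    ((DefPred.eq (.var (Sum.inr ())) (.const (α := Unit ⊕ Unit) 0)).not.and hR)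
  convert h0.or h1 using 2 with v
  simp only [Function.comp]
  cases h : decode (α := α) (v (Sum.inl ())) with
  | none => simp
  | some a =>
    cases v (Sum.inr ()) <;> simp [eq_comm]

@[fun_prop]
theorem Arith.lt {f g : α → ℕ} (hf : Arith f) (hg : Arith g) : Arith fun a => f a < g a :=
  (Arith.of_primrecRel Primrec.nat_lt).comp (hf.pair hg)

@[fun_prop]
theorem Arith.le {f g : α → ℕ} (hf : Arith f) (hg : Arith g) : Arith fun a => f a ≤ g a :=
  (Arith.of_primrecRel Primrec.nat_le).comp (hf.pair hg)

@[fun_prop]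
theorem Arith.add {f g : α → ℕ} (hf : Arith f) (hg : Arith g) : Arith fun a => f a + g a :=
  (Primrec₂.arith Primrec.nat_add).comp (hf.pair hg)

@[fun_prop]
theorem Arith.mul {f g : α → ℕ} (hf : Arith f) (hg : Arith g) : Arith fun a => f a * g a :=
  (Primrec₂.arith Primrec.nat_mul).comp (hf.pair hg)

@[fun_prop]
theorem Arith.div {f g : α → ℕ} (hf : Arith f) (hg : Arith g) : Arith fun a => f a / g a :=
  (Primrec₂.arith Primrec.nat_div).comp (hf.pair hg)

@[fun_prop]
theorem Arith.natPair {f g : α → ℕ} (hf : Arith f) (hg : Arith g) :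
    Arith fun a => Nat.pair (f a) (g a) :=
  (Primrec₂.arith Primrec₂.natPair).comp (hf.pair hg)

@[fun_prop]
theorem Arith.unpair {f : α → ℕ} (hf : Arith f) : Arith fun a => Nat.unpair (f a) :=
  (Primrec.arith Primrec.unpair).comp hf

@[fun_prop]
theorem Arith.encode {f : α → β} (hf : Arith f) : Arith fun a => encode (f a) :=
  (Primrec.arith Primrec.encode).comp hf

@[fun_prop]
theorem Arith.some {f : α → β} (hf : Arith f) : Arith fun a => Option.some (f a) :=
  (Primrec.arith Primrec.option_some).comp hf

@[fun_prop]
theorem Arith.cons {f : α → β} {l : α → List β} (hf : Arith f) (hl : Arith l) :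
    Arith fun a => f a :: l a :=
  (Primrec₂.arith Primrec.list_cons).comp (hf.pair hl)

@[fun_prop]
theorem Arith.append {l l' : α → List β} (hl : Arith l) (hl' : Arith l') :
    Arith fun a => l a ++ l' a :=
  (Primrec₂.arith Primrec.list_append).comp (hl.pair hl')

@[fun_prop]
theorem Arith.length {l : α → List β} (hl : Arith l) : Arith fun a => (l a).length :=
  (Primrec.arith Primrec.list_length).comp hl

@[fun_prop]
theorem Arith.range {f : α → ℕ} (hf : Arith f) : Arith fun a => List.range (f a) :=
  (Primrec.arith Primrec.list_range).comp hf

@[fun_prop]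
theorem Arith.getElem? {l : α → List β} {f : α → ℕ} (hl : Arith l) (hf : Arith f) :
    Arith fun a => (l a)[f a]? :=
  (Primrec₂.arith Primrec.list_getElem?).comp (hl.pair hf)

@[fun_prop]
theorem Arith.getD {l : α → List β} {f : α → ℕ} {d : β} (hl : Arith l) (hf : Arith f) :
    Arith fun a => (l a).getD (f a) d :=
  (Primrec₂.arith (Primrec.list_getD d)).comp (hl.pair hf)

@[fun_prop]
theorem Arith.flatten {l : α → List (List β)} (hl : Arith l) : Arith fun a => (l a).flatten :=
  (Primrec.arith Primrec.list_flatten).comp hl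

@[fun_prop]
theorem Arith.mem {f : α → β} {l : α → List β} (hf : Arith f) (hl : Arith l) :
    Arith fun a => f a ∈ l a :=
  (show Arith fun a => ∃ i : ℕ, (l a)[i]? = Option.some (f a) by fun_prop).congr fun a => by
    rw [List.mem_iff_getElem?]

@[fun_prop]
theorem Arith.map {f : α → β → γ} {l : α → List β} (hf : Arith fun x : α × β => f x.1 x.2)
    (hl : Arith l) : Arith fun a => (l a).map (f a) :=
  .of_graph <| (show Arith fun x : α × List γ => x.2.length = (l x.1).length ∧
    ∀ (i : ℕ) (b : β), (l x.1)[i]? = Option.some b → x.2[i]? = Option.some (f x.1 b) by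
      fun_prop).congr fun x => by
    rw [eq_iff_iff]
    constructor
    · rintro ⟨h1, h2⟩
      refine List.ext_getElem? fun i => ?_
      rw [List.getElem?_map]
      rcases h : (l x.1)[i]? with _ | b
      · rw [List.getElem?_eq_none_iff] at h
        rw [Option.map_none, eq_comm, List.getElem?_eq_none_iff]
        omega
      · rw [h2 i b h, Option.map_some]
    · intro h
      rw [← h]
      simp +contextual

/-! ### Inductively generated predicates -/

/-- The least predicate closed under a rule. -/
inductive Gen {α : Type} (R : List α → α → Prop) : α → Prop
  | mk (ps : List α) (a : α) : R ps a → (∀ p ∈ ps, Gen R p) → Gen R a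

theorem gen_iff {α : Type} {R : List α → α → Prop} (c : α) : Gen R c ↔ ∃ D : List α, c ∈ D ∧
    ∀ (D₁ : List α) (a : α) (D₂ : List α), D = D₁ ++ a :: D₂ → ∃ ps, R ps a ∧ ∀ p ∈ ps, p ∈ D₂ := by
  constructor
  · intro h
    induction h with
    | mk ps a hR _ ih =>
      have : ∀ qs : List α, (∀ q ∈ qs, q ∈ ps) → ∃ D : List α, (∀ q ∈ qs, q ∈ D) ∧
          ∀ (D₁ : List α) (a : α) (D₂ : List α), D = D₁ ++ a :: D₂ →
            ∃ ps, R ps a ∧ ∀ p ∈ ps, p ∈ D₂ := by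
        intro qs hqs
        induction qs with
        | nil => exact ⟨[], by simp, by simp⟩
        | cons q qs ihq =>
          obtain ⟨D, hD, hD'⟩ := ihq fun q hq => hqs q (by simp [hq])
          obtain ⟨E, hE, hE'⟩ := ih q (hqs q (by simp))
          refine ⟨E ++ D, ?_, ?_⟩
          · intro r hr
            rcases List.mem_cons.1 hr with rfl | hr
            · simp [hE]
            · simp [hD r hr]
          · intro D₁ a D₂ h
            rcases List.append_eq_append_iff.1 h with ⟨F, h1, h2⟩ | ⟨F, h1, h2⟩
            · exact hD' F a D₂ h2
            · cases F with
              | nil => exact hD' [] a D₂ (by simpa using h2.symm)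
              | cons b F =>
                simp only [List.cons_append, List.cons.injEq] at h2
                obtain ⟨rfl, rfl⟩ := h2
                obtain ⟨ps, h3, h4⟩ := hE' _ _ _ h1
                exact ⟨ps, h3, fun p hp => by simp [h4 p hp]⟩
      obtain ⟨D, hD, hD'⟩ := this ps fun _ => id
      refine ⟨a :: D, by simp, ?_⟩
      intro D₁ b D₂ h
      cases D₁ with
      | nil =>
        simp only [List.nil_append, List.cons.injEq] at h
        obtain ⟨rfl, rfl⟩ := h
        exact ⟨ps, hR, hD⟩
      | cons d D₁ =>
        simp only [List.cons_append, List.cons.injEq] at h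
        exact hD' D₁ b D₂ h.2
  · rintro ⟨D, hc, hD⟩
    have : ∀ E F : List α, D = F ++ E → ∀ c ∈ E, Gen R c := by
      intro E
      induction E with
      | nil => simp
      | cons a E ih =>
        intro F h c hc
        have ih' := ih (F ++ [a]) (by simp [h])
        rcases List.mem_cons.1 hc with rfl | hc
        · obtain ⟨ps, h1, h2⟩ := hD _ _ _ h
          exact .mk ps _ h1 fun p hp => ih' p (h2 p hp)
        · exact ih' c hc
    exact this D [] rfl c hc

theorem Arith.gen {R : List α → α → Prop} (hR : Arith fun x : List α × α => R x.1 x.2) :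
    Arith (Gen R) :=
  (show Arith fun c => ∃ D : List α, c ∈ D ∧
    ∀ (D₁ : List α) (a : α) (D₂ : List α), D = D₁ ++ a :: D₂ →
      ∃ ps, R ps a ∧ ∀ p ∈ ps, p ∈ D₂ by fun_prop).congr fun c => by rw [← gen_iff]

/-! ### Arithmetical dependent choice -/

theorem exists_arith_seq {R : ℕ → α → α → Prop} {P : ℕ → α → Prop}
    (hR : Arith fun x : ℕ × α × α => R x.1 x.2.1 x.2.2) (hP : Arith fun x : ℕ × α => P x.1 x.2)
    (a₀ : α) (h₀ : P 0 a₀) (hs : ∀ s a, P s a → ∃ b, R s a b ∧ P (s + 1) b) :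
    ∃ f : ℕ → α, Arith f ∧ f 0 = a₀ ∧ ∀ s, P s (f s) ∧ R s (f s) (f (s + 1)) := by
  classical
  let Q : ℕ → α → α → Prop := fun s a b =>
    (R s a b ∧ P (s + 1) b) ∧ ∀ b', Encodable.encode b' < Encodable.encode b →
      ¬ (R s a b' ∧ P (s + 1) b')
  have hQ : Arith fun x : ℕ × α × α => Q x.1 x.2.1 x.2.2 := by fun_prop
  have hex : ∀ s a, P s a → ∃ b, Q s a b := by
    intro s a ha
    let S : Set ℕ := {n | ∃ b, Encodable.encode b = n ∧ R s a b ∧ P (s + 1) b}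
    have hS : S.Nonempty := by
      obtain ⟨b, hb⟩ := hs s a ha
      exact ⟨_, b, rfl, hb⟩
    obtain ⟨b, hb, hb'⟩ := Nat.sInf_mem hS
    refine ⟨b, hb', fun b' hlt h' => ?_⟩
    rw [hb] at hlt
    exact Nat.notMem_of_lt_sInf hlt ⟨b', rfl, h'⟩
  have huniq : ∀ s a b b', Q s a b → Q s a b' → b = b' := by
    intro s a b b' h h'
    refine Encodable.encode_injective (le_antisymm ?_ ?_)
    · exact not_lt.1 fun hlt => h.2 _ hlt h'.1
    · exact not_lt.1 fun hlt => h'.2 _ hlt h.1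
  let next : ℕ → α → α := fun s a => if h : ∃ b, Q s a b then h.choose else a
  let f : ℕ → α := fun s => Nat.rec a₀ next s
  have hPf : ∀ s, P s (f s) ∧ Q s (f s) (f (s + 1)) := by
    have key : ∀ s, P s (f s) → Q s (f s) (f (s + 1)) := by
      intro s h
      have h' := hex s _ h
      change Q s (f s) (next s (f s))
      simp only [next, dif_pos h']
      exact h'.choose_spec
    have : ∀ s, P s (f s) := by
      intro s
      induction s with
      | zero => exact h₀
      | succ s ih => exact (key s ih).1.2
    exact fun s => ⟨this s, key s (this s)⟩
  refine ⟨f, .of_graph ?_, rfl, fun s => ⟨(hPf s).1, (hPf s).2.1.1⟩⟩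
  refine (show Arith fun x : ℕ × α => ∃ l : List α, l[0]? = Option.some a₀ ∧
    (∀ i : ℕ, i < x.1 → ∃ c d, l[i]? = Option.some c ∧ l[i + 1]? = Option.some d ∧ Q i c d) ∧
      l[x.1]? = Option.some x.2 by fun_prop).congr fun x => ?_
  rw [eq_iff_iff]
  constructor
  · rintro ⟨l, h0, h1, h2⟩
    have : ∀ i ≤ x.1, l[i]? = Option.some (f i) := by
      intro i hi
      induction i with
      | zero => exact h0
      | succ i ih =>
        obtain ⟨c, d, hc, hd, hcd⟩ := h1 i (by omega)
        rw [ih (by omega), Option.some_inj] at hc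
        rw [hd, huniq i c d (f (i + 1)) hcd (hc ▸ (hPf i).2)]
    rw [this _ le_rfl, Option.some_inj] at h2
    exact h2
  · intro h
    refine ⟨(List.range (x.1 + 1)).map f, ?_, ?_, ?_⟩
    · simp [f]
    · intro i hi
      refine ⟨f i, f (i + 1), ?_, ?_, (hPf i).2⟩ <;>
      · rw [List.getElem?_map, List.getElem?_range (by omega)]; rfl
    · rw [List.getElem?_map, List.getElem?_range (by omega), ← h]; rfl

/-! ### An arithmetical basis theorem -/

/-- If some valuation avoids an arithmetical set of forbidden finite patterns, then so does an
arithmetical one. -/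
theorem exists_arith_avoiding {B : List (α × Bool) → Prop} (hB : Arith B) (V₀ : α → Prop)
    (hV₀ : ∀ p, B p → ∃ x ∈ p, ¬ (V₀ x.1 ↔ x.2 = true)) :
    ∃ V : α → Prop, Arith V ∧ ∀ p, B p → ∃ x ∈ p, ¬ (V x.1 ↔ x.2 = true) := by
  classical
  let Ok : ℕ → List Bool → Prop := fun m τ => m ≤ τ.length ∧ ∀ p, Encodable.encode p < m → B p →
    ∃ x : α × Bool, x ∈ p ∧ τ[Encodable.encode x.1]? ≠ Option.some x.2
  have hOk : Arith fun x : ℕ × List Bool => Ok x.1 x.2 := by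
    simp only [Ok, ne_eq]; fun_prop
  have hmono : ∀ m m' τ, m ≤ m' → Ok m' τ → Ok m τ := fun m m' τ h h' =>
    ⟨h.trans h'.1, fun p hp => h'.2 p (hp.trans_le h)⟩
  let Good : List Bool → Prop := fun σ => ∀ m, ∃ ρ : List Bool, Ok m (σ ++ ρ)
  have hGood : Arith Good := by fun_prop
  obtain ⟨f, hf, h0, hstep⟩ := exists_arith_seq (α := List Bool)
    (R := fun _ σ τ => ∃ b, τ = σ ++ [b]) (P := fun s σ => σ.length = s ∧ Good σ)
    (by fun_prop) (by fun_prop) [] (by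
      refine ⟨rfl, fun m => ?_⟩
      let val : ℕ → Bool := fun n => decide (∃ a : α, Encodable.encode a = n ∧ V₀ a)
      refine ⟨(List.range m).map val, by simp, fun p _ hp => ?_⟩
      obtain ⟨x, hx, hx'⟩ := hV₀ p hp
      refine ⟨x, hx, fun h => hx' ?_⟩
      rw [List.nil_append, List.getElem?_map] at h
      obtain ⟨n, hn, hn'⟩ := Option.map_eq_some_iff.1 h
      rw [List.getElem?_eq_some_iff] at hn
      obtain ⟨_, hn⟩ := hn
      rw [List.getElem_range] at hn
      subst hn
      rw [← hn']
      simp [val]) (by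
      rintro s σ ⟨hs, hσ⟩
      by_contra! hcon
      have h1 := fun b => not_forall.1 fun h : Good (σ ++ [b]) =>
        hcon (σ ++ [b]) ⟨b, rfl⟩ (by simp [hs]) h
      choose m hm using h1
      obtain ⟨ρ, hρ⟩ := hσ (max (s + 1) (max (m true) (m false)))
      cases ρ with
      | nil =>
        have := hρ.1
        simp [hs] at this
      | cons b ρ =>
        refine hm b ⟨ρ, ?_⟩
        rw [List.append_assoc, List.singleton_append]
        refine hmono _ _ _ ?_ hρ
        cases b <;> simp)
  have hpre : ∀ s t, s ≤ t → ∀ (n : ℕ) (b : Bool),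
      (f s)[n]? = Option.some b → (f t)[n]? = Option.some b := by
    intro s t hst n b h
    induction t, hst using Nat.le_induction with
    | base => exact h
    | succ t _ ih =>
      obtain ⟨c, hc⟩ := (hstep t).2
      rw [hc, List.getElem?_append_left]
      · exact ih
      · exact (List.getElem?_eq_some_iff.1 ih).1
  refine ⟨fun a => (f (Encodable.encode a + 1))[Encodable.encode a]? = Option.some true,
    by fun_prop, fun p hp => ?_⟩
  by_contra! hcon
  obtain ⟨N, hN⟩ : ∃ N, ∀ x ∈ p, Encodable.encode x.1 < N := by
    clear hp hcon
    induction p with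
    | nil => exact ⟨0, by simp⟩
    | cons y p ih =>
      obtain ⟨N, hN⟩ := ih
      refine ⟨max N (Encodable.encode y.1 + 1), fun x hx => ?_⟩
      rcases List.mem_cons.1 hx with rfl | hx
      · simp
      · exact lt_max_of_lt_left (hN x hx)
  obtain ⟨ρ, hρ⟩ := (hstep N).1.2 (Encodable.encode p + 1)
  obtain ⟨x, hx, hx'⟩ := hρ.2 p (Nat.lt_succ_self _) hp
  refine hx' ?_
  have hl := (hstep N).1.1
  rw [List.getElem?_append_left (by rw [hl]; exact hN x hx)]
  refine hpre (Encodable.encode x.1 + 1) N (hN x hx) _ _ ?_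
  have hlen : Encodable.encode x.1 < (f (Encodable.encode x.1 + 1)).length := by
    rw [(hstep _).1.1]; exact Nat.lt_succ_self _
  have := hcon x hx
  rw [List.getElem?_eq_getElem hlen, Option.some_inj] at this ⊢
  rcases h1 : x.2 <;> simp_all

end Arith

/-! ## Token lists of terms and formulas -/

section Tokens

open Encodable

variable {L : FirstOrder.Language.{0, 0}} (g : GoedelCoding L) {α β : Type}

/-- The list of tokens underlying `termCode`. -/
def termToks (enc : α → ℕ) (t : L.Term α) : List ℕ :=
  t.listEncode.map (Sum.elim (fun a => Nat.pair 0 (enc a))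
    (fun p => Nat.pair 1 (Nat.pair p.1 (g.encFun p.1 p.2))))

/-- The coding of free and bound variables used inside formulas. -/
def varEnc (enc : α → ℕ) (n : ℕ) : α ⊕ Fin n → ℕ :=
  Sum.elim (fun a => Nat.pair 0 (enc a)) (fun i => Nat.pair 1 i.1)

/-- The token of a term occurring in a formula. -/
def termTok (n : ℕ) (l : List ℕ) : ℕ := Nat.pair 0 (Nat.pair n (encode l))

/-- The list of tokens underlying `formulaCode`. -/
def formToks (enc : α → ℕ) {n : ℕ} (φ : L.BoundedFormula α n) : List ℕ :=
  φ.listEncode.map (Sum.elim (fun p => termTok p.1 (termToks g (varEnc enc p.1) p.2))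
    (Sum.elim (fun q => Nat.pair 1 (Nat.pair q.1 (g.encRel q.1 q.2))) (fun m => Nat.pair 2 m)))

theorem termToks_var (enc : α → ℕ) (a : α) :
    termToks g enc (Term.var a : L.Term α) = [Nat.pair 0 (enc a)] := rfl

theorem termToks_func (enc : α → ℕ) {k : ℕ} (f : L.Functions k) (ts : Fin k → L.Term α) :
    termToks g enc (Term.func f ts) = Nat.pair 1 (Nat.pair k (g.encFun k f)) ::
      (List.ofFn fun i => termToks g enc (ts i)).flatten := by
  simp [termToks, Term.listEncode, List.flatMap_def, List.ofFn_eq_map,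
    Function.comp_def]

variable {n : ℕ} (enc : α → ℕ)

theorem formToks_falsum :
    formToks g enc (BoundedFormula.falsum : L.BoundedFormula α n) = [Nat.pair 2 (n + 2)] := rfl

theorem formToks_equal (t₁ t₂ : L.Term (α ⊕ Fin n)) :
    formToks g enc (BoundedFormula.equal t₁ t₂) =
      [termTok n (termToks g (varEnc enc n) t₁), termTok n (termToks g (varEnc enc n) t₂)] := rfl

theorem formToks_rel {k : ℕ} (R : L.Relations k) (ts : Fin k → L.Term (α ⊕ Fin n)) :
    formToks g enc (BoundedFormula.rel R ts) = Nat.pair 1 (Nat.pair k (g.encRel k R)) ::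
      Nat.pair 2 n :: (List.ofFn fun i => termToks g (varEnc enc n) (ts i)).map (termTok n) := by
  simp [formToks, BoundedFormula.listEncode, List.ofFn_eq_map, Function.comp_def]

theorem formToks_imp (φ ψ : L.BoundedFormula α n) :
    formToks g enc (φ.imp ψ) = Nat.pair 2 0 :: (formToks g enc φ ++ formToks g enc ψ) := by
  simp [formToks, BoundedFormula.listEncode]

theorem formToks_all (φ : L.BoundedFormula α (n + 1)) :
    formToks g enc φ.all = Nat.pair 2 1 :: formToks g enc φ := by
  simp [formToks, BoundedFormula.listEncode]

/-! ### Unique readability -/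

theorem varEnc_injective {enc : α → ℕ} (h : Function.Injective enc) (n : ℕ) :
    Function.Injective (varEnc enc n) := by
  rintro (a | i) (b | j) hij
  · simpa [varEnc, h.eq_iff] using hij
  · simp [varEnc] at hij
  · simp [varEnc] at hij
  · simpa [varEnc, Fin.ext_iff] using hij

theorem termToks_injective {enc : α → ℕ} (h : Function.Injective enc) :
    Function.Injective (termToks g enc : L.Term α → List ℕ) := by
  refine Function.Injective.comp (List.map_injective_iff.2 ?_) Term.listEncode_injective
  rintro (a | ⟨k, f⟩) (b | ⟨l, f'⟩) hab
  · simpa [h.eq_iff] using hab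
  · simp at hab
  · simp at hab
  · simp only [Sum.elim_inr, Nat.pair_eq_pair, true_and] at hab
    obtain ⟨rfl, hab⟩ := hab
    rw [g.encFun_inj _ hab]

theorem formToks_sigma_injective {enc : α → ℕ} (h : Function.Injective enc) :
    Function.Injective fun φ : Σ n, L.BoundedFormula α n => formToks g enc φ.2 := by
  refine Function.Injective.comp (g := List.map _) (List.map_injective_iff.2 ?_)
    BoundedFormula.listEncode_sigma_injective
  rintro (⟨n, t⟩ | ⟨k, R⟩ | m) (⟨n', t'⟩ | ⟨k', R'⟩ | m') hab
  · simp only [Sum.elim_inl, termTok, Nat.pair_eq_pair, true_and, encode_inj] at hab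
    obtain ⟨rfl, hab⟩ := hab
    rw [termToks_injective g (varEnc_injective h n) hab]
  any_goals simp [termTok] at hab
  · obtain ⟨rfl, hab⟩ := hab
    rw [g.encRel_inj _ hab]
  · rw [hab]

theorem formToks_injective {enc : α → ℕ} (h : Function.Injective enc) :
    Function.Injective (formToks g enc : L.BoundedFormula α n → List ℕ) := by
  intro φ ψ hφ
  simpa using @formToks_sigma_injective L g α enc h ⟨n, φ⟩ ⟨n, ψ⟩ hφ

/-! ### Renaming free variables -/

/-- Rename the free variables of a bounded formula. -/
def mapFree (f : α → β) (φ : L.BoundedFormula α n) : L.BoundedFormula β n :=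
  φ.mapTermRel (fun _ t => t.relabel (Sum.map f id)) (fun _ => id) (fun _ => id)

theorem realize_mapFree {M : Type} [L.Structure M] (f : α → β) (φ : L.BoundedFormula α n)
    (v : β → M) (xs : Fin n → M) : (mapFree f φ).Realize v xs ↔ φ.Realize (v ∘ f) xs := by
  refine BoundedFormula.realize_mapTermRel_id (fun k t xs => ?_) (by simp)
  rw [Term.realize_relabel]
  congr 1
  ext (a | i) <;> rfl

theorem termToks_relabel (enc : β → ℕ) (f : α → β) (t : L.Term α) :
    termToks g enc (t.relabel f) = termToks g (enc ∘ f) t := by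
  induction t with
  | var a => rfl
  | func F ts ih =>
    rw [Term.relabel, termToks_func, termToks_func]
    simp [ih]

theorem formToks_mapFree (enc : β → ℕ) (f : α → β) (φ : L.BoundedFormula α n) :
    formToks g enc (mapFree f φ) = formToks g (enc ∘ f) φ := by
  have hv : ∀ n, varEnc enc n ∘ Sum.map f id = varEnc (enc ∘ f) n := by
    intro n
    ext (a | i) <;> rfl
  unfold mapFree
  induction φ with
  | falsum => rfl
  | equal t₁ t₂ =>
    simp [BoundedFormula.mapTermRel, formToks_equal, termToks_relabel, hv]
  | rel R ts =>
    simp [BoundedFormula.mapTermRel, formToks_rel, termToks_relabel, hv]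
  | imp _ _ ih₁ ih₂ =>
    rw [BoundedFormula.mapTermRel, formToks_imp, formToks_imp, ih₁, ih₂]
  | all _ ih =>
    rw [BoundedFormula.mapTermRel, formToks_all, formToks_all, ← ih]
    rfl

/-! ### Arithmetical recognition of token lists -/

/-- `c` codes a `k`-ary function symbol. -/
def IsFunCode (k c : ℕ) : Prop := Nat.pair 0 (Nat.pair k c) ∈ symbolCodes g

/-- `c` codes a `k`-ary relation symbol. -/
def IsRelCode (k c : ℕ) : Prop := Nat.pair 1 (Nat.pair k c) ∈ symbolCodes g

theorem isFunCode_iff {k c : ℕ} : IsFunCode g k c ↔ ∃ f : L.Functions k, c = g.encFun k f := by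
  constructor
  · rintro (⟨n, f, h⟩ | ⟨n, R, h⟩)
    · simp only [Nat.pair_eq_pair, true_and] at h
      obtain ⟨rfl, rfl⟩ := h
      exact ⟨f, rfl⟩
    · simp at h
  · rintro ⟨f, rfl⟩
    exact Or.inl ⟨k, f, rfl⟩

theorem isRelCode_iff {k c : ℕ} : IsRelCode g k c ↔ ∃ R : L.Relations k, c = g.encRel k R := by
  constructor
  · rintro (⟨n, f, h⟩ | ⟨n, R, h⟩)
    · simp at h
    · simp only [Nat.pair_eq_pair, true_and] at h
      obtain ⟨rfl, rfl⟩ := h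
      exact ⟨R, rfl⟩
  · rintro ⟨f, rfl⟩
    exact Or.inr ⟨k, f, rfl⟩

/-- Membership in a set of variable codes that is either everything or a finite list. -/
def Allowed (s : Option (List ℕ)) (a : ℕ) : Prop := ∀ l, s = some l → a ∈ l

/-- The rule generating token lists of terms with `n` bound variables. -/
def termRule (ps : List (Option (List ℕ) × ℕ × List ℕ)) (x : Option (List ℕ) × ℕ × List ℕ) :
    Prop :=
  (∃ a, Allowed x.1 a ∧ x.2.2 = [Nat.pair 0 (Nat.pair 0 a)]) ∨
  (∃ i, i < x.2.1 ∧ x.2.2 = [Nat.pair 0 (Nat.pair 1 i)]) ∨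
  ∃ (k c : ℕ) (qs : List (List ℕ)), IsFunCode g k c ∧ qs.length = k ∧
    x.2.2 = Nat.pair 1 (Nat.pair k c) :: qs.flatten ∧ ps = qs.map fun q => (x.1, x.2.1, q)

/-- `l` is the token list of a term with `n` bound variables. -/
def TermL (s : Option (List ℕ)) (n : ℕ) (l : List ℕ) : Prop := Gen (termRule g) (s, n, l)

/-- The rule generating token lists of formulas. -/
def formRule (ps : List (Option (List ℕ) × ℕ × List ℕ)) (x : Option (List ℕ) × ℕ × List ℕ) :
    Prop :=
  x.2.2 = [Nat.pair 2 (x.2.1 + 2)] ∨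
  (∃ q₁ q₂, TermL g x.1 x.2.1 q₁ ∧ TermL g x.1 x.2.1 q₂ ∧
    x.2.2 = [termTok x.2.1 q₁, termTok x.2.1 q₂]) ∨
  (∃ (k c : ℕ) (qs : List (List ℕ)), IsRelCode g k c ∧ qs.length = k ∧
    (∀ q, q ∈ qs → TermL g x.1 x.2.1 q) ∧
    x.2.2 = Nat.pair 1 (Nat.pair k c) :: Nat.pair 2 x.2.1 :: qs.map fun q => termTok x.2.1 q) ∨
  (∃ l₁ l₂, ps = [(x.1, x.2.1, l₁), (x.1, x.2.1, l₂)] ∧ x.2.2 = Nat.pair 2 0 :: (l₁ ++ l₂)) ∨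
  (∃ l₁, ps = [(x.1, x.2.1 + 1, l₁)] ∧ x.2.2 = Nat.pair 2 1 :: l₁)

/-- `l` is the token list of a formula with `n` bound variables. -/
def FormL (s : Option (List ℕ)) (n : ℕ) (l : List ℕ) : Prop := Gen (formRule g) (s, n, l)

@[fun_prop]
theorem Arith.termTok {γ : Type} [Primcodable γ] {f : γ → ℕ} {l : γ → List ℕ}
    (hf : Arith f) (hl : Arith l) : Arith fun a => termTok (f a) (l a) := by
  unfold ArMorley.termTok
  fun_prop

variable {g}

theorem ArithLang.isFunCode (hL : ArithLang g) : Arith fun x : ℕ × ℕ => IsFunCode g x.1 x.2 :=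
  (isArithmetical_iff_arith.1 hL).comp
    (f := fun x : ℕ × ℕ => Nat.pair 0 (Nat.pair x.1 x.2)) (by fun_prop)

theorem ArithLang.isRelCode (hL : ArithLang g) : Arith fun x : ℕ × ℕ => IsRelCode g x.1 x.2 :=
  (isArithmetical_iff_arith.1 hL).comp
    (f := fun x : ℕ × ℕ => Nat.pair 1 (Nat.pair x.1 x.2)) (by fun_prop)

theorem ArithLang.termL (hL : ArithLang g) :
    Arith fun x : Option (List ℕ) × ℕ × List ℕ => TermL g x.1 x.2.1 x.2.2 := by
  have := hL.isFunCode
  exact Arith.gen (by unfold termRule Allowed; fun_prop)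

theorem ArithLang.formL (hL : ArithLang g) :
    Arith fun x : Option (List ℕ) × ℕ × List ℕ => FormL g x.1 x.2.1 x.2.2 := by
  have := hL.isRelCode
  have := hL.termL
  exact Arith.gen (by unfold formRule; fun_prop)

theorem termL_termToks {s : Option (List ℕ)} {enc : α → ℕ} (h : ∀ a, Allowed s (enc a))
    (t : L.Term (α ⊕ Fin n)) : TermL g s n (termToks g (varEnc enc n) t) := by
  induction t with
  | var a =>
    rcases a with a | i
    · exact .mk [] _ (Or.inl ⟨enc a, h a, rfl⟩) (by simp)
    · exact .mk [] _ (Or.inr (Or.inl ⟨i, i.2, rfl⟩)) (by simp)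
  | @func k f ts ih =>
    rw [termToks_func]
    refine .mk ((List.ofFn fun i => termToks g (varEnc enc n) (ts i)).map fun q => (s, n, q)) _
      (Or.inr (Or.inr ⟨k, _, _, (isFunCode_iff g).2 ⟨f, rfl⟩, by simp, rfl, rfl⟩)) ?_
    simpa [List.mem_ofFn, TermL] using ih

theorem List.eq_ofFn_of_forall {A B : Type} {f : A → B} {qs : List B} {k : ℕ} (h : qs.length = k)
    (hq : ∀ q ∈ qs, ∃ a, q = f a) : ∃ ts : Fin k → A, qs = List.ofFn fun i => f (ts i) := by
  subst h
  have : ∀ i : Fin qs.length, ∃ a, qs[i] = f a := fun i => hq _ (List.getElem_mem _)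
  choose ts hts using this
  exact ⟨ts, by simp only [← hts]; exact (List.ofFn_getElem).symm⟩

theorem TermL.exists_term {s : Option (List ℕ)} {enc : α → ℕ}
    (h : ∀ c, Allowed s c → ∃ a, enc a = c) {l : List ℕ} (hl : TermL g s n l) :
    ∃ t : L.Term (α ⊕ Fin n), l = termToks g (varEnc enc n) t := by
  unfold TermL at hl
  generalize hx : (s, n, l) = x at hl
  induction hl generalizing l with
  | mk ps x hR _ ih =>
    subst hx
    rcases hR with ⟨a, ha, hl⟩ | ⟨i, hi, hl⟩ | ⟨k, c, qs, hc, hk, hl, hps⟩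
    · obtain ⟨a, rfl⟩ := h a ha
      exact ⟨Term.var (Sum.inl a), hl⟩
    · exact ⟨Term.var (Sum.inr ⟨i, hi⟩), hl⟩
    · obtain ⟨f, rfl⟩ := (isFunCode_iff g).1 hc
      obtain ⟨ts, rfl⟩ := List.eq_ofFn_of_forall hk fun q hq =>
        ih (s, n, q) (by rw [hps]; exact List.mem_map_of_mem hq) rfl
      exact ⟨Term.func f ts, by rw [termToks_func]; exact hl⟩

theorem formL_formToks {s : Option (List ℕ)} {enc : α → ℕ} (h : ∀ a, Allowed s (enc a))
    (φ : L.BoundedFormula α n) : FormL g s n (formToks g enc φ) := by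
  induction φ with
  | falsum => exact .mk [] _ (Or.inl rfl) (by simp)
  | equal t₁ t₂ =>
    exact .mk [] _ (Or.inr (Or.inl ⟨_, _, termL_termToks h t₁, termL_termToks h t₂, rfl⟩)) (by simp)
  | @rel n k R ts =>
    rw [formToks_rel]
    refine .mk [] _ (Or.inr (Or.inr (Or.inl
      ⟨k, _, _, (isRelCode_iff g).2 ⟨R, rfl⟩, by simp, ?_, rfl⟩))) (by simp)
    intro q hq
    obtain ⟨i, rfl⟩ := (List.mem_ofFn' _ _).1 hq
    exact termL_termToks h _
  | imp φ ψ ih₁ ih₂ =>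
    rw [formToks_imp]
    refine .mk _ _ (Or.inr (Or.inr (Or.inr (Or.inl ⟨_, _, rfl, rfl⟩)))) ?_
    simpa using ⟨ih₁, ih₂⟩
  | all φ ih =>
    rw [formToks_all]
    refine .mk _ _ (Or.inr (Or.inr (Or.inr (Or.inr ⟨_, rfl, rfl⟩)))) ?_
    simpa [FormL] using ih

theorem FormL.exists_formula {s : Option (List ℕ)} {enc : α → ℕ}
    (h : ∀ c, Allowed s c → ∃ a, enc a = c) {l : List ℕ} (hl : FormL g s n l) :
    ∃ φ : L.BoundedFormula α n, l = formToks g enc φ := by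
  unfold FormL at hl
  generalize hx : (s, n, l) = x at hl
  induction hl generalizing n l with
  | mk ps x hR _ ih =>
    subst hx
    rcases hR with hl | ⟨q₁, q₂, h₁, h₂, hl⟩ | ⟨k, c, qs, hc, hk, hq, hl⟩ | ⟨l₁, l₂, hps, hl⟩ |
      ⟨l₁, hps, hl⟩
    · exact ⟨BoundedFormula.falsum, hl⟩
    · obtain ⟨t₁, rfl⟩ := h₁.exists_term h
      obtain ⟨t₂, rfl⟩ := h₂.exists_term h
      exact ⟨BoundedFormula.equal t₁ t₂, hl⟩
    · obtain ⟨R, rfl⟩ := (isRelCode_iff g).1 hc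
      obtain ⟨ts, rfl⟩ := List.eq_ofFn_of_forall hk fun q hq' => (hq q hq').exists_term h
      exact ⟨BoundedFormula.rel R ts, by rw [formToks_rel]; exact hl⟩
    · obtain ⟨φ, rfl⟩ := ih (s, n, l₁) (by simp [hps]) rfl
      obtain ⟨ψ, rfl⟩ := ih (s, n, l₂) (by simp [hps]) rfl
      exact ⟨φ.imp ψ, by rw [formToks_imp]; exact hl⟩
    · obtain ⟨φ, rfl⟩ := ih (s, n + 1, l₁) (by simp [hps]) rfl
      exact ⟨φ.all, by rw [formToks_all]; exact hl⟩

end Tokens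

/-! ## An arithmetical model with domain `ℕ` -/

section Enumeration

variable {N : Type} [Infinite N]

open Classical in
/-- An injective enumeration answering the `s`-th requirement `A s` at stage `s`, if possible. -/
noncomputable def answers (A : ℕ → (ℕ → N) → N → Prop) (c₀ : N) (s : ℕ) : N :=
  let r : ℕ → N := fun i => if _h : i < s then answers A c₀ i else c₀
  if h : ∃ y, A s r y ∧ ∀ i < s, r i ≠ y then h.choose
  else (Infinite.exists_notMem_finset ((Finset.range s).image r)).choose
termination_by s

theorem answers_spec (A : ℕ → (ℕ → N) → N → Prop) (c₀ : N) :
    Function.Injective (answers A c₀) ∧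
    ∀ s, (∃ y, A s (fun i => if i < s then answers A c₀ i else c₀) y) →
      ∃ j ≤ s, A s (fun i => if i < s then answers A c₀ i else c₀) (answers A c₀ j) := by
  classical
  have hfresh : ∀ s, ∀ i < s, answers A c₀ i ≠ answers A c₀ s := by
    intro s i hi
    conv_rhs => rw [answers]
    simp only [dite_eq_ite]
    split_ifs with h
    · have := h.choose_spec.2 i hi
      rwa [if_pos hi] at this
    · intro h'
      refine (Infinite.exists_notMem_finset ((Finset.range s).image
        fun i => if i < s then answers A c₀ i else c₀)).choose_spec ?_
      rw [← h']
      exact Finset.mem_image.2 ⟨i, Finset.mem_range.2 hi, if_pos hi⟩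
  refine ⟨fun i j hij => ?_, fun s hs => ?_⟩
  · rcases lt_trichotomy i j with h | h | h
    · exact (hfresh j i h hij).elim
    · exact h
    · exact (hfresh i j h hij.symm).elim
  · by_cases h : ∃ y, A s (fun i => if i < s then answers A c₀ i else c₀) y ∧
      ∀ i < s, (if i < s then answers A c₀ i else c₀) ≠ y
    · refine ⟨s, le_rfl, ?_⟩
      conv in answers A c₀ s => rw [answers]
      simp only [dite_eq_ite]
      rw [dif_pos h]
      exact h.choose_spec.1
    · push Not at h
      obtain ⟨y, hy⟩ := hs
      obtain ⟨i, hi, rfl⟩ := h y hy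
      rw [if_pos hi] at hy
      exact ⟨i, hi.le, hy⟩

end Enumeration

section Diagram

open Encodable

variable {L : FirstOrder.Language.{0, 0}} (g : GoedelCoding L)

/-- Atomic facts about a structure whose elements are named by natural numbers. -/
abbrev Fact : Type := ℕ × List ℕ × List ℕ × List ℕ × ℕ

/-- The fact `c(is) = j` for a function symbol. -/
abbrev factFun (c : ℕ) (is : List ℕ) (j : ℕ) : Fact := (0, [c], is, [], j)

/-- The fact `c(is)` for a relation symbol. -/
abbrev factRel (c : ℕ) (is : List ℕ) : Fact := (1, [c], is, [], 0)

/-- The fact `l(v, xs) = j` for a term. -/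
abbrev factTerm (l v xs : List ℕ) (j : ℕ) : Fact := (2, l, v, xs, j)

/-- The fact `l(v, xs)` for a formula. -/
abbrev factSat (l v xs : List ℕ) : Fact := (3, l, v, xs, 0)

/-- The list of tokens of a function symbol applied to terms. -/
abbrev funcL (c : ℕ) (ls : List (List ℕ)) : List ℕ :=
  Nat.pair 1 (Nat.pair ls.length c) :: ls.flatten

/-- The list of tokens of a relation symbol applied to terms. -/
abbrev relL (n c : ℕ) (ls : List (List ℕ)) : List ℕ :=
  Nat.pair 1 (Nat.pair ls.length c) :: Nat.pair 2 n :: ls.map fun q => termTok n q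

/-- The search bound for a requirement. -/
abbrev taskBound (k : ℕ) (l v xs : List ℕ) (m : ℕ) : ℕ := Nat.pair (encode (k, l, v, xs)) m

/-- Forbidden patterns concerning function values. -/
def patFun (p : List (Fact × Bool)) : Prop :=
  (∃ (c m : ℕ) (is : List ℕ), IsFunCode g is.length c ∧ 0 < m ∧ (∀ i, i ∈ is → i < m) ∧
    p = (List.range (taskBound 0 [c] is [] m + 1)).map fun j => (factFun c is j, false)) ∨
  (∃ (c : ℕ) (is : List ℕ) (j j' : ℕ), ¬ j = j' ∧
    p = [(factFun c is j, true), (factFun c is j', true)])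

/-- Forbidden patterns concerning terms. -/
def patTerm (p : List (Fact × Bool)) : Prop :=
  (∃ (a : ℕ) (v xs : List ℕ),
    p = [(factTerm [Nat.pair 0 (Nat.pair 0 a)] v xs (v.getD a 0), false)]) ∨
  (∃ (i : ℕ) (v xs : List ℕ), i < xs.length ∧
    p = [(factTerm [Nat.pair 0 (Nat.pair 1 i)] v xs (xs.getD i 0), false)]) ∨
  (∃ (c j : ℕ) (q : List (List ℕ × ℕ)) (v xs : List ℕ), IsFunCode g q.length c ∧
    p = (factFun c (q.map fun y => y.2) j, true) ::
      (factTerm (funcL c (q.map fun y => y.1)) v xs j, false) ::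
        q.map fun y => (factTerm y.1 v xs y.2, true)) ∨
  (∃ (l v xs : List ℕ) (j j' : ℕ), ¬ j = j' ∧
    p = [(factTerm l v xs j, true), (factTerm l v xs j', true)])

/-- Forbidden patterns concerning formulas. -/
def patSat (p : List (Fact × Bool)) : Prop :=
  (∃ v xs : List ℕ, p = [(factSat [Nat.pair 2 (xs.length + 2)] v xs, true)]) ∨
  (∃ (l₁ l₂ v xs : List ℕ) (j₁ j₂ : ℕ) (b : Bool), TermL g none xs.length l₁ ∧
    TermL g none xs.length l₂ ∧ (b = true ↔ ¬ j₁ = j₂) ∧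
    p = [(factTerm l₁ v xs j₁, true), (factTerm l₂ v xs j₂, true),
      (factSat [termTok xs.length l₁, termTok xs.length l₂] v xs, b)]) ∨
  (∃ (c : ℕ) (b b' : Bool) (q : List (List ℕ × ℕ)) (v xs : List ℕ), IsRelCode g q.length c ∧
    (∀ y, y ∈ q → TermL g none xs.length y.1) ∧ ¬ b = b' ∧
    p = (factRel c (q.map fun y => y.2), b) ::
      (factSat (relL xs.length c (q.map fun y => y.1)) v xs, b') ::
        q.map fun y => (factTerm y.1 v xs y.2, true)) ∨
  (∃ (l₁ l₂ v xs : List ℕ) (b₁ b₂ b : Bool), FormL g none xs.length l₁ ∧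
    FormL g none xs.length l₂ ∧ ¬ (b = true ↔ (b₁ = true → b₂ = true)) ∧
    p = [(factSat l₁ v xs, b₁), (factSat l₂ v xs, b₂),
      (factSat (Nat.pair 2 0 :: (l₁ ++ l₂)) v xs, b)])

/-- `l` is the token list of an axiom. -/
def IsAxiomL (T : L.Theory) (l : List ℕ) : Prop := encode l ∈ theoryCode g T

/-- Forbidden patterns concerning quantifiers and axioms. -/
def patQuant (T : L.Theory) (p : List (Fact × Bool)) : Prop :=
  (∃ (l v xs : List ℕ) (j : ℕ), FormL g none (xs.length + 1) l ∧
    p = [(factSat (Nat.pair 2 1 :: l) v xs, true), (factSat l v (xs ++ [j]), false)]) ∨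
  (∃ (l v xs : List ℕ) (m : ℕ), FormL g none (xs.length + 1) l ∧ 0 < m ∧
    (∀ i, i ∈ v → i < m) ∧ (∀ i, i ∈ xs → i < m) ∧
    p = (factSat (Nat.pair 2 1 :: l) v xs, false) ::
      (List.range (taskBound 1 l v xs m + 1)).map fun j => (factSat l v (xs ++ [j]), true)) ∨
  (∃ l : List ℕ, IsAxiomL g T l ∧ p = [(factSat l [] [], false)])

/-- The forbidden patterns. -/
def pat (T : L.Theory) (p : List (Fact × Bool)) : Prop :=
  patFun g p ∨ patTerm g p ∨ patSat g p ∨ patQuant g T p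

variable {g}

theorem arith_pat {T : L.Theory} (hL : ArithLang g) (hT : ArithTheory g T) : Arith (pat g T) := by
  have h1 := hL.isFunCode
  have h2 := hL.isRelCode
  have h3 := hL.termL
  have h4 := hL.formL
  have h5 : Arith (IsAxiomL g T) :=
    (isArithmetical_iff_arith.1 hT).comp (f := fun l : List ℕ => encode l) (by fun_prop)
  have f1 : Arith (patFun g) := by
    unfold patFun
    fun_prop
  have f2 : Arith (patTerm g) := by
    unfold patTerm
    fun_prop
  have f3 : Arith (patSat g) := by
    unfold patSat
    fun_prop
  have f4 : Arith (patQuant g T) := by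
    unfold patQuant
    fun_prop
  unfold pat
  fun_prop

end Diagram

theorem exists_eq_ofFn {A : Type} (xs : List A) : ∃ (n : ℕ) (w : Fin n → A), xs = List.ofFn w :=
  ⟨xs.length, xs.get, (List.ofFn_get xs).symm⟩

theorem exists_pair_ofFn {A B : Type} (q : List (A × B)) :
    ∃ (n : ℕ) (a : Fin n → A) (b : Fin n → B), q = List.ofFn fun i => (a i, b i) :=
  ⟨q.length, fun i => (q.get i).1, fun i => (q.get i).2, (List.ofFn_get q).symm⟩

theorem ofFn_eq_ofFn {A : Type} {m n : ℕ} {a : Fin m → A} {b : Fin n → A}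
    (h : List.ofFn a = List.ofFn b) : ∃ h : m = n, a = b ∘ Fin.cast h := by
  have := List.ofFn_inj'.1 h
  obtain rfl : m = n := congrArg Sigma.fst this
  exact ⟨rfl, by simpa using this⟩

section Truth

open Encodable

variable {L : FirstOrder.Language.{0, 0}} (g : GoedelCoding L) {N : Type} [L.Structure N]
  (ν : ℕ → N)

/-- The assignment coded by a list. -/
def listVal (v : List ℕ) (a : ℕ) : N := ν (v.getD a 0)

/-- The facts true in a structure with named elements. -/
def truth : Fact → Prop
  | (0, l, is, _, j) => ∃ (k : ℕ) (f : L.Functions k) (w : Fin k → ℕ), l = [g.encFun k f] ∧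
      is = List.ofFn w ∧ ν j = Structure.funMap f (ν ∘ w)
  | (1, l, is, _, _) => ∃ (k : ℕ) (R : L.Relations k) (w : Fin k → ℕ), l = [g.encRel k R] ∧
      is = List.ofFn w ∧ Structure.RelMap R (ν ∘ w)
  | (2, l, v, xs, j) => ∃ (n : ℕ) (t : L.Term (ℕ ⊕ Fin n)) (w : Fin n → ℕ),
      l = termToks g (varEnc id n) t ∧ xs = List.ofFn w ∧
      ν j = t.realize (Sum.elim (listVal ν v) (ν ∘ w))
  | (_, l, v, xs, _) => ∃ (n : ℕ) (φ : L.BoundedFormula ℕ n) (w : Fin n → ℕ),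
      l = formToks g id φ ∧ xs = List.ofFn w ∧ φ.Realize (listVal ν v) (ν ∘ w)

variable {g ν} {n k : ℕ}

theorem truth_fun {f : L.Functions k} {w : Fin k → ℕ} {j : ℕ} :
    truth g ν (factFun (g.encFun k f) (List.ofFn w) j) ↔ ν j = Structure.funMap f (ν ∘ w) := by
  constructor
  · rintro ⟨k', f', w', h1, h2, h3⟩
    obtain ⟨rfl, rfl⟩ := ofFn_eq_ofFn h2
    rw [List.singleton_inj, (g.encFun_inj k).eq_iff] at h1
    subst h1
    exact h3
  · exact fun h => ⟨k, f, w, rfl, rfl, h⟩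

theorem truth_rel {R : L.Relations k} {w : Fin k → ℕ} :
    truth g ν (factRel (g.encRel k R) (List.ofFn w)) ↔ Structure.RelMap R (ν ∘ w) := by
  constructor
  · rintro ⟨k', f', w', h1, h2, h3⟩
    obtain ⟨rfl, rfl⟩ := ofFn_eq_ofFn h2
    rw [List.singleton_inj, (g.encRel_inj k).eq_iff] at h1
    subst h1
    exact h3
  · exact fun h => ⟨k, R, w, rfl, rfl, h⟩

theorem truth_term_iff {l v : List ℕ} {w : Fin n → ℕ} {j : ℕ} :
    truth g ν (factTerm l v (List.ofFn w) j) ↔ ∃ t : L.Term (ℕ ⊕ Fin n),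
      l = termToks g (varEnc id n) t ∧ ν j = t.realize (Sum.elim (listVal ν v) (ν ∘ w)) := by
  constructor
  · rintro ⟨k', t, w', h1, h2, h3⟩
    obtain ⟨rfl, rfl⟩ := ofFn_eq_ofFn h2
    exact ⟨t, h1, h3⟩
  · exact fun ⟨t, h, h'⟩ => ⟨n, t, w, h, rfl, h'⟩

theorem truth_term {t : L.Term (ℕ ⊕ Fin n)} {v : List ℕ} {w : Fin n → ℕ} {j : ℕ} :
    truth g ν (factTerm (termToks g (varEnc id n) t) v (List.ofFn w) j) ↔
      ν j = t.realize (Sum.elim (listVal ν v) (ν ∘ w)) := by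
  rw [truth_term_iff]
  constructor
  · rintro ⟨t', h1, h2⟩
    rwa [termToks_injective g (varEnc_injective Function.injective_id n) h1]
  · exact fun h => ⟨t, rfl, h⟩

theorem truth_sat {φ : L.BoundedFormula ℕ n} {v : List ℕ} {w : Fin n → ℕ} :
    truth g ν (factSat (formToks g id φ) v (List.ofFn w)) ↔
      φ.Realize (listVal ν v) (ν ∘ w) := by
  constructor
  · rintro ⟨k', t, w', h1, h2, h3⟩
    obtain ⟨rfl, rfl⟩ := ofFn_eq_ofFn h2
    rw [formToks_injective g Function.injective_id h1]
    exact h3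
  · exact fun h => ⟨n, φ, w, rfl, rfl, h⟩

theorem funcL_ofFn (f : L.Functions k) (ts : Fin k → L.Term (ℕ ⊕ Fin n)) :
    funcL (g.encFun k f) (List.ofFn fun i => termToks g (varEnc id n) (ts i)) =
      termToks g (varEnc id n) (Term.func f ts) := by
  rw [termToks_func, funcL, List.length_ofFn]

theorem relL_ofFn (R : L.Relations k) (ts : Fin k → L.Term (ℕ ⊕ Fin n)) :
    relL n (g.encRel k R) (List.ofFn fun i => termToks g (varEnc id n) (ts i)) =
      formToks g id (BoundedFormula.rel R ts) := by
  rw [formToks_rel, relL, List.length_ofFn]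

/-- A valuation matches a pattern. -/
def Matches (V : Fact → Prop) (p : List (Fact × Bool)) : Prop := ∀ x ∈ p, (V x.1 ↔ x.2 = true)

theorem matches_nil {V : Fact → Prop} : Matches V [] ↔ True := by simp [Matches]

theorem matches_cons {V : Fact → Prop} {x : Fact × Bool} {p : List (Fact × Bool)} :
    Matches V (x :: p) ↔ (V x.1 ↔ x.2 = true) ∧ Matches V p := by simp [Matches]

theorem matches_map {V : Fact → Prop} {A : Type} {f : A → Fact × Bool} {l : List A} :
    Matches V (l.map f) ↔ ∀ a ∈ l, (V (f a).1 ↔ (f a).2 = true) := by simp [Matches]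

theorem matches_ofFn {V : Fact → Prop} {f : Fin n → Fact × Bool} :
    Matches V (List.ofFn f) ↔ ∀ i, (V (f i).1 ↔ (f i).2 = true) := by
  simp [Matches, List.mem_ofFn]

theorem allowed_none (a : ℕ) : Allowed none a := by simp [Allowed]

theorem exists_id_eq (c : ℕ) (_ : Allowed none c) : ∃ a, id a = c := ⟨c, rfl⟩

theorem not_matches_patFun_truth (hν : Function.Injective ν)
    (hb : ∀ (k : ℕ) (f : L.Functions k) (w : Fin k → ℕ) (m : ℕ), 0 < m → (∀ i, w i < m) →
      ∃ j ≤ taskBound 0 [g.encFun k f] (List.ofFn w) [] m, ν j = Structure.funMap f (ν ∘ w))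
    {p : List (Fact × Bool)} (hp : patFun g p) : ¬ Matches (truth g ν) p := by
  rcases hp with ⟨c, m, is, hc, hm, his, rfl⟩ | ⟨c, is, j, j', hj, rfl⟩
  · obtain ⟨k, w, rfl⟩ := exists_eq_ofFn is
    rw [List.length_ofFn] at hc
    obtain ⟨f, rfl⟩ := (isFunCode_iff g).1 hc
    obtain ⟨j, hj, hj'⟩ := hb k f w m hm fun i => his _ (by simp [List.mem_ofFn])
    rw [matches_map]
    intro h
    simpa using (h j (by simpa using Nat.lt_succ_of_le hj)).1 (truth_fun.2 hj')
  · simp only [matches_cons, iff_true, matches_nil, and_true]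
    rintro ⟨⟨k, f, w, h1, rfl, h2⟩, h3⟩
    rw [List.singleton_inj] at h1
    subst h1
    rw [truth_fun] at h3
    exact hj (hν (h2.trans h3.symm))

theorem not_matches_patTerm_truth (hν : Function.Injective ν)
    {p : List (Fact × Bool)} (hp : patTerm g p) : ¬ Matches (truth g ν) p := by
  rcases hp with ⟨a, v, xs, rfl⟩ | ⟨i, v, xs, hi, rfl⟩ | ⟨c, j, q, v, xs, hc, rfl⟩ |
    ⟨l, v, xs, j, j', hj, rfl⟩ <;> obtain ⟨n, w, rfl⟩ := exists_eq_ofFn xs <;>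
    simp only [matches_cons, matches_nil, and_true, Bool.false_eq_true, iff_false, not_not,
      iff_true]
  · exact truth_term_iff.2 ⟨Term.var (Sum.inl a), rfl, rfl⟩
  · rw [List.length_ofFn] at hi
    exact truth_term_iff.2 ⟨Term.var (Sum.inr ⟨i, hi⟩), rfl, by simp [List.getD, hi]⟩
  · obtain ⟨k, a, b, rfl⟩ := exists_pair_ofFn q
    rw [List.length_ofFn] at hc
    obtain ⟨f, rfl⟩ := (isFunCode_iff g).1 hc
    simp only [List.map_ofFn, Function.comp_def, matches_ofFn, truth_fun, iff_true,
      truth_term_iff]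
    rintro ⟨h1, h2, h3⟩
    choose ts hts hts' using h3
    refine h2 ⟨Term.func f ts, ?_, ?_⟩
    · simp only [hts, ← funcL_ofFn]
    · rw [h1]
      simp only [Term.realize]
      congr 1
      ext i
      exact hts' i
  · rw [truth_term_iff]
    rintro ⟨⟨t, rfl, h1⟩, h2⟩
    rw [truth_term] at h2
    exact hj (hν (h1.trans h2.symm))

theorem not_matches_patSat_truth (hν : Function.Injective ν)
    {p : List (Fact × Bool)} (hp : patSat g p) : ¬ Matches (truth g ν) p := by
  rcases hp with ⟨v, xs, rfl⟩ | ⟨l₁, l₂, v, xs, j₁, j₂, b, h₁, h₂, hb, rfl⟩ |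
    ⟨c, b, b', q, v, xs, hc, hq, hb, rfl⟩ | ⟨l₁, l₂, v, xs, b₁, b₂, b, h₁, h₂, hb, rfl⟩ <;>
    obtain ⟨n, w, rfl⟩ := exists_eq_ofFn xs <;>
    simp only [matches_cons, matches_nil, and_true, iff_true, List.length_ofFn] at *
  · rw [← formToks_falsum g id, truth_sat]
    exact id
  · obtain ⟨t₁, rfl⟩ := h₁.exists_term exists_id_eq
    obtain ⟨t₂, rfl⟩ := h₂.exists_term exists_id_eq
    rw [truth_term, truth_term, ← formToks_equal g id, truth_sat, BoundedFormula.Realize, hb]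
    rintro ⟨h1, h2, h3⟩
    rw [← h1, ← h2, hν.eq_iff] at h3
    tauto
  · obtain ⟨k, a, d, rfl⟩ := exists_pair_ofFn q
    rw [List.length_ofFn] at hc
    obtain ⟨R, rfl⟩ := (isRelCode_iff g).1 hc
    simp only [List.map_ofFn, Function.comp_def, matches_ofFn, truth_rel, iff_true] at *
    have hq' : ∀ i, ∃ t : L.Term (ℕ ⊕ Fin n), a i = termToks g (varEnc id n) t := fun i =>
      (hq (a i, d i) (List.mem_ofFn.2 ⟨i, rfl⟩)).exists_term exists_id_eq
    choose ts hts using hq'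
    simp only [hts, relL_ofFn, truth_sat, truth_term]
    rintro ⟨h1, h2, h3⟩
    rw [BoundedFormula.Realize] at h2
    simp only [← h3] at h2
    rw [h1] at h2
    exact hb (Bool.eq_iff_iff.2 h2)
  · obtain ⟨φ, rfl⟩ := h₁.exists_formula exists_id_eq
    obtain ⟨ψ, rfl⟩ := h₂.exists_formula exists_id_eq
    rw [truth_sat, truth_sat, ← formToks_imp g id, truth_sat, BoundedFormula.realize_imp]
    rintro ⟨h1, h2, h3⟩
    rw [h1, h2] at h3
    exact hb h3.symm

theorem comp_snoc (w : Fin n → ℕ) (j : ℕ) :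
    ν ∘ (Fin.snoc w j : Fin (n + 1) → ℕ) = Fin.snoc (ν ∘ w) (ν j) := Fin.comp_snoc ν w j

theorem ofFn_snoc (w : Fin n → ℕ) (j : ℕ) :
    List.ofFn w ++ [j] = List.ofFn (Fin.snoc w j : Fin (n + 1) → ℕ) := by
  rw [List.ofFn_succ']
  simp

theorem not_matches_patQuant_truth {T : L.Theory} (hT : ∀ φ ∈ T, Sentence.Realize N φ)
    (hb : ∀ (n : ℕ) (φ : L.BoundedFormula ℕ (n + 1)) (v : List ℕ) (w : Fin n → ℕ) (m : ℕ), 0 < m →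
      (∀ i ∈ v, i < m) → (∀ i, w i < m) → ¬ φ.all.Realize (listVal ν v) (ν ∘ w) →
      ∃ j ≤ taskBound 1 (formToks g id φ) v (List.ofFn w) m,
        ¬ φ.Realize (listVal ν v) (Fin.snoc (ν ∘ w) (ν j)))
    {p : List (Fact × Bool)} (hp : patQuant g T p) : ¬ Matches (truth g ν) p := by
  rcases hp with ⟨l, v, xs, j, h, rfl⟩ | ⟨l, v, xs, m, h, hm, hv, hxs, rfl⟩ | ⟨l, hl, rfl⟩
  · obtain ⟨n, w, rfl⟩ := exists_eq_ofFn xs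
    simp only [List.length_ofFn] at h
    obtain ⟨φ, rfl⟩ := h.exists_formula exists_id_eq
    simp only [matches_cons, matches_nil, and_true, iff_true, ← formToks_all, truth_sat,
      ofFn_snoc, comp_snoc]
    rintro ⟨h1, h2⟩
    simpa using h2.1 (h1 (ν j))
  · obtain ⟨n, w, rfl⟩ := exists_eq_ofFn xs
    simp only [List.length_ofFn] at h
    obtain ⟨φ, rfl⟩ := h.exists_formula exists_id_eq
    simp only [matches_cons, matches_map, ← formToks_all, truth_sat,
      ofFn_snoc, comp_snoc]
    rintro ⟨h1, h2⟩
    obtain ⟨j, hj, hj'⟩ := hb n φ v w m hm hv (fun i => hxs _ (List.mem_ofFn.2 ⟨i, rfl⟩))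
      (by simpa using h1)
    exact hj' ((h2 j (by simpa using Nat.lt_succ_of_le hj)).2 trivial)
  · obtain ⟨φ, hφ, hl⟩ := hl
    have : l = formToks g id (mapFree (Empty.elim : Empty → ℕ) φ) := by
      rw [formToks_mapFree]
      refine (encode_injective hl).trans ?_
      congr 1
    subst this
    simp only [matches_cons, matches_nil, and_true, Bool.false_eq_true, iff_false, not_not]
    have h0 : ([] : List ℕ) = List.ofFn (Fin.elim0 : Fin 0 → ℕ) := by simp
    have := (truth_sat (g := g) (ν := ν) (φ := mapFree (Empty.elim : Empty → ℕ) φ) (v := [])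
      (w := Fin.elim0)).2 (by
        rw [realize_mapFree]
        refine Eq.mp ?_ (hT φ hφ)
        unfold Sentence.Realize Formula.Realize
        congr 1 <;> exact Subsingleton.elim _ _)
    rwa [← h0] at this

end Truth

section Requirements

open Encodable

variable {L : FirstOrder.Language.{0, 0}} (g : GoedelCoding L) {N : Type} [L.Structure N]

/-- The requirement met at stage `s` of the enumeration of a model: name a value of a function, or
a counterexample to a universal formula. -/
def Requirement (s : ℕ) (ρ : ℕ → N) (y : N) : Prop :=
  (∃ (k : ℕ) (f : L.Functions k) (w : Fin k → ℕ) (m : ℕ), 0 < m ∧ (∀ i, w i < m) ∧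
    s = taskBound 0 [g.encFun k f] (List.ofFn w) [] m ∧ y = Structure.funMap f (ρ ∘ w)) ∨
  (∃ (n : ℕ) (φ : L.BoundedFormula ℕ (n + 1)) (v : List ℕ) (w : Fin n → ℕ) (m : ℕ), 0 < m ∧
    (∀ i ∈ v, i < m) ∧ (∀ i, w i < m) ∧
    s = taskBound 1 (formToks g id φ) v (List.ofFn w) m ∧
    ¬ φ.Realize (listVal ρ v) (Fin.snoc (ρ ∘ w) y))

theorem exists_naming (N : Type) [L.Structure N] [Infinite N] : ∃ ν : ℕ → N, Function.Injective ν ∧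
    (∀ (k : ℕ) (f : L.Functions k) (w : Fin k → ℕ) (m : ℕ), 0 < m → (∀ i, w i < m) →
      ∃ j ≤ taskBound 0 [g.encFun k f] (List.ofFn w) [] m, ν j = Structure.funMap f (ν ∘ w)) ∧
    (∀ (n : ℕ) (φ : L.BoundedFormula ℕ (n + 1)) (v : List ℕ) (w : Fin n → ℕ) (m : ℕ), 0 < m →
      (∀ i ∈ v, i < m) → (∀ i, w i < m) → ¬ φ.all.Realize (listVal ν v) (ν ∘ w) →
      ∃ j ≤ taskBound 1 (formToks g id φ) v (List.ofFn w) m,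
        ¬ φ.Realize (listVal ν v) (Fin.snoc (ν ∘ w) (ν j))) := by
  obtain ⟨c₀⟩ : Nonempty N := inferInstance
  obtain ⟨hinj, hspec⟩ := answers_spec (Requirement g) c₀
  set ν := answers (Requirement g) c₀ with hν
  have hw : ∀ {k s m : ℕ} {w : Fin k → ℕ}, m ≤ s → (∀ i, w i < m) →
      (fun i => if i < s then ν i else c₀) ∘ w = ν ∘ w := by
    intro k s m w hm hw
    ext i
    exact if_pos ((hw i).trans_le hm)
  have hv : ∀ {s m : ℕ} {v : List ℕ}, m ≤ s → 0 < m → (∀ i ∈ v, i < m) →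
      listVal (fun i => if i < s then ν i else c₀) v = listVal ν v := by
    intro s m v hm h0 hv
    ext a
    refine if_pos (lt_of_lt_of_le ?_ hm)
    by_cases ha : a < v.length
    · rw [List.getD_eq_getElem _ _ ha]
      exact hv _ (List.getElem_mem _)
    · rwa [List.getD_eq_default _ _ (not_lt.1 ha)]
  refine ⟨ν, hinj, ?_, ?_⟩
  · intro k f w m hm hwm
    obtain ⟨j, hj, hj'⟩ := hspec (taskBound 0 [g.encFun k f] (List.ofFn w) [] m)
      ⟨_, Or.inl ⟨k, f, w, m, hm, hwm, rfl, rfl⟩⟩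
    refine ⟨j, hj, ?_⟩
    rcases hj' with ⟨k', f', w', m', -, -, h, h'⟩ | ⟨n, φ, v', w', m', -, -, -, h, -⟩
    · simp only [Nat.pair_eq_pair, encode_inj, Prod.mk.injEq, true_and] at h
      obtain ⟨⟨h1, h2, -⟩, -⟩ := h
      obtain ⟨rfl, rfl⟩ := ofFn_eq_ofFn h2
      rw [List.singleton_inj, (g.encFun_inj k).eq_iff] at h1
      subst h1
      simp only [Fin.cast_refl, Function.comp_id] at hwm h' ⊢
      rwa [hw (Nat.right_le_pair _ m) hwm] at h'
    · simp [Nat.pair_eq_pair] at h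
  · intro n φ v w m hm hvm hwm hφ
    rw [BoundedFormula.realize_all, not_forall] at hφ
    obtain ⟨y, hy⟩ := hφ
    have hle : m ≤ taskBound 1 (formToks g id φ) v (List.ofFn w) m := Nat.right_le_pair _ m
    obtain ⟨j, hj, hj'⟩ := hspec (taskBound 1 (formToks g id φ) v (List.ofFn w) m)
      ⟨y, Or.inr ⟨n, φ, v, w, m, hm, hvm, hwm, rfl, by
        rwa [hw hle hwm, hv hle hm hvm]⟩⟩
    refine ⟨j, hj, ?_⟩
    rcases hj' with ⟨k', f', w', m', -, -, h, h'⟩ | ⟨n, φ', v', w', m', -, -, -, h, h'⟩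
    · simp [Nat.pair_eq_pair] at h
    · simp only [Nat.pair_eq_pair, encode_inj, Prod.mk.injEq, true_and] at h
      obtain ⟨⟨h1, rfl, h2⟩, -⟩ := h
      obtain ⟨rfl, rfl⟩ := ofFn_eq_ofFn h2
      obtain rfl := formToks_injective g Function.injective_id h1
      simp only [Fin.cast_refl, Function.comp_id] at hwm hle h' ⊢
      rwa [hw hle hwm, hv hle hm hvm] at h'

variable {g}

theorem exists_arith_truth {T : L.Theory} (hL : ArithLang g) (hT : ArithTheory g T)
    {N : Type} [L.Structure N] [Infinite N] (hN : ∀ φ ∈ T, Sentence.Realize N φ) :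
    ∃ V : Fact → Prop, Arith V ∧ ∀ p, pat g T p → ¬ Matches V p := by
  obtain ⟨ν, hν, h1, h2⟩ := exists_naming g N
  have key : ∀ (V : Fact → Prop) p, (∃ x ∈ p, ¬ (V x.1 ↔ x.2 = true)) ↔ ¬ Matches V p := by
    simp only [Matches, not_forall, exists_prop, implies_true]
  simp only [← key]
  refine exists_arith_avoiding (arith_pat hL hT) (truth g ν) fun p hp => ?_
  rw [key]
  rcases hp with hp | hp | hp | hp
  · exact not_matches_patFun_truth hν h1 hp
  · exact not_matches_patTerm_truth hν hp
  · exact not_matches_patSat_truth hν hp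
  · exact not_matches_patQuant_truth hN h2 hp

end Requirements

section ReadOff

open Encodable

variable {L : FirstOrder.Language.{0, 0}} {g : GoedelCoding L} {T : L.Theory} {V : Fact → Prop}

theorem exists_structure_of_not_matches (hV : ∀ p, pat g T p → ¬ Matches V p) :
    ∃ S : L.Structure ℕ,
      (∀ (k : ℕ) (f : L.Functions k) (w : Fin k → ℕ),
        V (factFun (g.encFun k f) (List.ofFn w) (S.funMap f w))) ∧
      ∀ (k : ℕ) (R : L.Relations k) (w : Fin k → ℕ),
        S.RelMap R w ↔ V (factRel (g.encRel k R) (List.ofFn w)) := by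
  have h : ∀ (k : ℕ) (f : L.Functions k) (w : Fin k → ℕ),
      ∃ j, V (factFun (g.encFun k f) (List.ofFn w) j) := by
    intro k f w
    by_contra! hj
    refine hV _ (Or.inl (Or.inl ⟨g.encFun k f, ∑ i, w i + 1, List.ofFn w, ?_, by omega, ?_,
      rfl⟩)) ?_
    · rw [List.length_ofFn]
      exact (isFunCode_iff g).2 ⟨f, rfl⟩
    · intro i hi
      obtain ⟨i, rfl⟩ := (List.mem_ofFn' _ _).1 hi
      exact Nat.lt_succ_of_le (Finset.single_le_sum (fun _ _ => Nat.zero_le _) (Finset.mem_univ i))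
    · rw [matches_map]
      simpa using fun j _ => hj j
  choose F hF using h
  exact ⟨⟨fun {k} f w => F k f w, fun {k} R w => V (factRel (g.encRel k R) (List.ofFn w))⟩, hF,
    fun _ _ _ => Iff.rfl⟩

variable [S : L.Structure ℕ] (hV : ∀ p, pat g T p → ¬ Matches V p)
  (hF : ∀ (k : ℕ) (f : L.Functions k) (w : Fin k → ℕ),
    V (factFun (g.encFun k f) (List.ofFn w) (S.funMap f w)))
  (hR : ∀ (k : ℕ) (R : L.Relations k) (w : Fin k → ℕ),
    S.RelMap R w ↔ V (factRel (g.encRel k R) (List.ofFn w)))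

include hV hF in
theorem factTerm_realize {n : ℕ} (t : L.Term (ℕ ⊕ Fin n)) (v : List ℕ) (w : Fin n → ℕ) :
    V (factTerm (termToks g (varEnc id n) t) v (List.ofFn w)
      (t.realize (Sum.elim (listVal id v) w))) := by
  induction t with
  | var a =>
    rcases a with a | i
    · by_contra h
      exact hV _ (Or.inr (Or.inl (Or.inl ⟨a, v, List.ofFn w, rfl⟩)))
        (by rw [matches_cons, matches_nil]
            simpa only [and_true, Bool.false_eq_true, iff_false] using! h)
    · by_contra h
      refine hV _ (Or.inr (Or.inl (Or.inr (Or.inl ⟨i, v, List.ofFn w, by simp, rfl⟩)))) ?_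
      simp only [matches_cons, matches_nil, and_true, Bool.false_eq_true, iff_false]
      simpa [List.getD, termToks_var, varEnc] using h
  | @func k f ts ih =>
    by_contra h
    refine hV _ (Or.inr (Or.inl (Or.inr (Or.inr (Or.inl ⟨g.encFun k f,
      (Term.func f ts).realize (Sum.elim (listVal id v) w),
      List.ofFn fun i => (termToks g (varEnc id n) (ts i),
        (ts i).realize (Sum.elim (listVal id v) w)), v, List.ofFn w,
      by rw [List.length_ofFn]; exact (isFunCode_iff g).2 ⟨f, rfl⟩, rfl⟩))))) ?_
    simp only [List.map_ofFn, Function.comp_def]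
    rw [funcL_ofFn, matches_cons, matches_cons, matches_ofFn]
    simpa using ⟨hF k f _, h, ih⟩

include hV hF hR in
theorem factSat_iff {n : ℕ} (φ : L.BoundedFormula ℕ n) (v : List ℕ) (w : Fin n → ℕ) :
    V (factSat (formToks g id φ) v (List.ofFn w)) ↔ φ.Realize (listVal id v) w := by
  classical
  induction φ with
  | @falsum n =>
    simp only [BoundedFormula.Realize, iff_false]
    intro h
    refine hV _ (Or.inr (Or.inr (Or.inl (Or.inl ⟨v, List.ofFn w, rfl⟩)))) ?_
    simpa [matches_cons, matches_nil, formToks_falsum] using h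
  | @equal n t₁ t₂ =>
    by_contra h
    refine hV _ (Or.inr (Or.inr (Or.inl (Or.inr (Or.inl ⟨termToks g (varEnc id n) t₁,
      termToks g (varEnc id n) t₂, v, List.ofFn w, t₁.realize (Sum.elim (listVal id v) w),
      t₂.realize (Sum.elim (listVal id v) w),
      decide (V (factSat (formToks g id (BoundedFormula.equal t₁ t₂)) v (List.ofFn w))),
      ?_, ?_, ?_, rfl⟩))))) ?_
    · rw [List.length_ofFn]; exact termL_termToks allowed_none t₁
    · rw [List.length_ofFn]; exact termL_termToks allowed_none t₂
    · rw [BoundedFormula.Realize] at h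
      simp only [decide_eq_true_eq]
      tauto
    · have h1 := factTerm_realize hV hF t₁ v w
      have h2 := factTerm_realize hV hF t₂ v w
      rw [formToks_equal, List.length_ofFn]
      simp only [matches_cons, matches_nil, h1, h2, decide_eq_true_eq, and_true]
  | @rel n k R ts =>
    by_contra h
    refine hV _ (Or.inr (Or.inr (Or.inl (Or.inr (Or.inr (Or.inl ⟨g.encRel k R,
      decide (V (factRel (g.encRel k R)
        (List.ofFn fun i => (ts i).realize (Sum.elim (listVal id v) w)))),
      decide (V (factSat (formToks g id (BoundedFormula.rel R ts)) v (List.ofFn w))),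
      List.ofFn fun i => (termToks g (varEnc id n) (ts i),
        (ts i).realize (Sum.elim (listVal id v) w)), v, List.ofFn w, ?_, ?_, ?_, rfl⟩)))))) ?_
    · rw [List.length_ofFn]
      exact (isRelCode_iff g).2 ⟨R, rfl⟩
    · simp only [List.length_ofFn, List.mem_ofFn]
      rintro y ⟨i, rfl⟩
      exact termL_termToks allowed_none (ts i)
    · simp only [BoundedFormula.Realize] at h
      erw [hR] at h
      simpa [not_iff, eq_comm, iff_comm] using h
    · simp only [List.map_ofFn, Function.comp_def]
      rw [List.length_ofFn, relL_ofFn, matches_cons, matches_cons, matches_ofFn]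
      simpa using fun i => factTerm_realize hV hF (ts i) v w
  | @imp n φ ψ ih₁ ih₂ =>
    by_contra h
    refine hV _ (Or.inr (Or.inr (Or.inl (Or.inr (Or.inr (Or.inr ⟨formToks g id φ,
      formToks g id ψ, v, List.ofFn w, decide (V (factSat (formToks g id φ) v (List.ofFn w))),
      decide (V (factSat (formToks g id ψ) v (List.ofFn w))),
      decide (V (factSat (formToks g id (φ.imp ψ)) v (List.ofFn w))), ?_, ?_, ?_, rfl⟩)))))) ?_
    · rw [List.length_ofFn]; exact formL_formToks allowed_none φ
    · rw [List.length_ofFn]; exact formL_formToks allowed_none ψ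
    · simpa [ih₁, ih₂, BoundedFormula.Realize] using h
    · simp [matches_cons, matches_nil, formToks_imp]
  | @all n φ ih =>
    simp only [BoundedFormula.Realize]
    have hφ : FormL g none ((List.ofFn w).length + 1) (formToks g id φ) := by
      rw [List.length_ofFn]; exact formL_formToks allowed_none φ
    constructor
    · intro h j
      by_contra hj
      refine hV _ (Or.inr (Or.inr (Or.inr (Or.inl ⟨formToks g id φ, v, List.ofFn w, j, hφ,
        rfl⟩)))) ?_
      rw [formToks_all] at h
      simp only [matches_cons, matches_nil, and_true, ofFn_snoc, ih, h]
      simpa using hj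
    · intro h
      by_contra hj
      refine hV _ (Or.inr (Or.inr (Or.inr (Or.inr (Or.inl ⟨formToks g id φ, v, List.ofFn w,
        v.sum + (List.ofFn w).sum + 1, hφ, by omega, ?_, ?_, rfl⟩))))) ?_
      · intro i hi
        have := List.le_sum_of_mem hi
        omega
      · intro i hi
        have := List.le_sum_of_mem hi
        omega
      · rw [formToks_all] at hj
        simp only [matches_cons, matches_map, ofFn_snoc, ih, h]
        simpa using hj

end ReadOff

section Model

variable {L : FirstOrder.Language.{0, 0}} (g : GoedelCoding L) [L.Structure ℕ]

/-- Satisfaction of coded formulas in a structure on `ℕ`. -/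
def Sat (l v : List ℕ) : Prop :=
  ∃ φ : L.Formula ℕ, l = formToks g id φ ∧ φ.Realize (listVal id v : ℕ → ℕ)

variable {g}

theorem sat_formToks {φ : L.Formula ℕ} {v : List ℕ} :
    Sat g (formToks g id φ) v ↔ φ.Realize (listVal id v : ℕ → ℕ) := by
  refine ⟨fun ⟨ψ, h, hψ⟩ => ?_, fun h => ⟨φ, rfl, h⟩⟩
  rwa [formToks_injective g Function.injective_id h]

end Model

theorem exists_arith_model {L : FirstOrder.Language.{0, 0}} {g : GoedelCoding L} {T : L.Theory}
    (hL : ArithLang g) (hT : ArithTheory g T)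
    {N : Type} [L.Structure N] [Infinite N] (hN : ∀ φ ∈ T, Sentence.Realize N φ) :
    ∃ _ : L.Structure ℕ, (∀ φ ∈ T, Sentence.Realize ℕ φ) ∧
      Arith fun x : List ℕ × List ℕ => Sat g x.1 x.2 := by
  obtain ⟨V, hVA, hV⟩ := exists_arith_truth hL hT hN
  obtain ⟨S, hF, hR⟩ := exists_structure_of_not_matches hV
  have key : ∀ (φ : L.Formula ℕ) (v : List ℕ),
      V (factSat (formToks g id φ) v []) ↔ φ.Realize (listVal id v : ℕ → ℕ) := by
    intro φ v
    have := factSat_iff hV hF hR φ v Fin.elim0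
    rw [List.ofFn_zero] at this
    rw [this, Formula.Realize]
    exact iff_of_eq (congrArg _ (Subsingleton.elim _ _))
  refine ⟨S, fun φ hφ => ?_, ?_⟩
  · have h1 : V (factSat (formToks g id (mapFree (Empty.elim : Empty → ℕ) φ)) [] []) := by
      by_contra h
      refine hV _ (Or.inr (Or.inr (Or.inr (Or.inr (Or.inr
        ⟨formToks g id (mapFree (Empty.elim : Empty → ℕ) φ), ?_, rfl⟩))))) ?_
      · refine ⟨φ, hφ, ?_⟩
        rw [formToks_mapFree]
        exact congrArg _ (congrArg (fun e => formToks g e φ) (Subsingleton.elim _ _))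
      · simpa [matches_cons, matches_nil] using h
    have := (key _ _).1 h1
    unfold Formula.Realize at this
    rw [realize_mapFree] at this
    unfold Sentence.Realize Formula.Realize
    convert this
  · have h4 := hL.formL
    refine Arith.congr (f := fun x : List ℕ × List ℕ =>
      FormL g none 0 x.1 ∧ V (factSat x.1 x.2 [])) (by fun_prop) ?_
    · rintro ⟨l, v⟩
      refine propext ⟨fun ⟨h, h'⟩ => ?_, ?_⟩
      · obtain ⟨φ, hφ⟩ := h.exists_formula exists_id_eq
        dsimp only at hφ
        subst hφ
        exact ⟨φ, rfl, (key φ v).1 h'⟩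
      · rintro ⟨φ, rfl, h⟩
        exact ⟨formL_formToks allowed_none φ, (key φ v).2 h⟩

section Coded

open Encodable

variable {L : FirstOrder.Language.{0, 0}} {g : GoedelCoding L} [L.Structure ℕ]

theorem sat_formToks_enc {α : Type} {enc : α → ℕ} {φ : L.Formula α} {v : List ℕ} :
    Sat g (formToks g enc φ) v ↔ φ.Realize fun a => v.getD (enc a) 0 := by
  have h : formToks g enc φ = formToks g id (mapFree enc φ) := (formToks_mapFree g id enc φ).symm
  rw [h]
  exact sat_formToks.trans (realize_mapFree enc φ _ _)

/-- The set of doubles of the elements of a set. -/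
def doubles (P : Set ℕ) : Set ℕ := {x | ∃ i ∈ P, x = 2 * i}

theorem infinite_compl_doubles (P : Set ℕ) : (doubles P)ᶜ.Infinite := by
  refine Set.infinite_of_injective_forall_mem (f := fun n : ℕ => 2 * n + 1) ?_ ?_
  · intro a b h
    simpa using h
  · rintro n ⟨i, -, h⟩
    omega

/-- The elements of `P` correspond to those of `doubles P`. -/
def doublesEquiv (P : L.ElementarySubstructure ℕ) : P ≃ doubles (P : Set ℕ) where
  toFun i := ⟨2 * i, i, i.2, rfl⟩
  invFun x := ⟨x / 2, by
    obtain ⟨i, hi, h⟩ := x.2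
    rw [h, Nat.mul_div_cancel_left _ two_pos]
    exact hi⟩
  left_inv i := by ext; simp
  right_inv x := by
    obtain ⟨i, hi, h⟩ := x.2
    ext
    simp [h]

/-- The coded structure whose elements are the doubles of those of a substructure. -/
def codedDoubles (P : L.ElementarySubstructure ℕ) : CodedStructure L where
  carrier := doubles P
  compl_infinite := infinite_compl_doubles P
  struc := (doublesEquiv P).inducedStructure

instance (P : L.ElementarySubstructure ℕ) : L.Structure (codedDoubles P).carrier :=
  (codedDoubles P).struc

/-- The isomorphism between a substructure and the coded structure of its doubles. -/
def codedDoublesEquiv (P : L.ElementarySubstructure ℕ) : P ≃[L] (codedDoubles P).carrier :=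
  (doublesEquiv P).inducedStructureEquiv

theorem realize_codedDoubles (P : L.ElementarySubstructure ℕ) {α : Type} (φ : L.Formula α)
    (a : α → (codedDoubles P).carrier) : φ.Realize a ↔ φ.Realize fun i => (a i : ℕ) / 2 := by
  rw [← StrongHomClass.realize_formula (codedDoublesEquiv P).symm φ,
    ← P.subtype.map_formula]
  rfl

theorem models_codedDoubles {T : L.Theory} (hT : ∀ φ ∈ T, Sentence.Realize ℕ φ)
    (P : L.ElementarySubstructure ℕ) : (codedDoubles P).Models T := by
  intro φ hφ
  have := (realize_codedDoubles P φ default).2 (by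
    have := hT φ hφ
    rw [Sentence.Realize] at this
    convert this)
  exact this

theorem arithDecidable_codedDoubles (hL : ArithLang g)
    (hS : Arith fun x : List ℕ × List ℕ => Sat g x.1 x.2) (P : L.ElementarySubstructure ℕ)
    (hP : Arith fun i => i ∈ P) : ArithDecidable g (codedDoubles P) := by
  have h4 := hL.formL
  generalize hQ : (fun i => i ∈ P) = Q at hP
  have hQ' : ∀ i, Q i ↔ i ∈ P := fun i => by rw [← hQ]
  refine isArithmetical_iff_arith.2 (Arith.congr (f := fun c : ℕ =>
    ∃ l a : List ℕ, c = Nat.pair (Nat.pair a.length (encode l)) (encode a) ∧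
      (∀ x, x ∈ a → ∃ i, Q i ∧ x = 2 * i) ∧ FormL g (some (List.range a.length)) 0 l ∧
      Sat g l (a.map fun x => x / 2)) (by fun_prop) ?_)
  intro c
  have key : ∀ {k : ℕ} (a : Fin k → ℕ) (i : Fin k),
      ((List.ofFn a).map fun x => x / 2).getD i 0 = a i / 2 := by
    intro k a i
    simp [List.getD]
  refine propext ⟨?_, ?_⟩
  · rintro ⟨l, a, rfl, ha, hl, hs⟩
    obtain ⟨k, a, rfl⟩ := exists_eq_ofFn a
    simp only [List.length_ofFn] at hl
    obtain ⟨φ, rfl⟩ := hl.exists_formula (α := Fin k) (enc := Fin.val) (fun c hc =>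
      ⟨⟨c, List.mem_range.1 (hc _ rfl)⟩, rfl⟩)
    have ha' : ∀ i, a i ∈ (codedDoubles P).carrier := fun i => by
      obtain ⟨j, hj, h⟩ := ha (a i) (List.mem_ofFn.2 ⟨i, rfl⟩)
      exact ⟨j, (hQ' j).1 hj, h⟩
    refine ⟨k, φ, fun i => ⟨a i, ha' i⟩, by simp only [List.length_ofFn]; rfl, ?_⟩
    refine (realize_codedDoubles P φ _).2 ?_
    rw [sat_formToks_enc] at hs
    simpa only [key] using hs
  · rintro ⟨k, φ, a, rfl, h⟩
    refine ⟨formToks g Fin.val φ, List.ofFn fun i => (a i : ℕ), by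
      simp only [List.length_ofFn]; rfl, ?_, ?_, ?_⟩
    · intro x hx
      obtain ⟨i, rfl⟩ := (List.mem_ofFn' _ _).1 hx
      obtain ⟨j, hj, h⟩ := (a i).2
      exact ⟨j, (hQ' j).2 hj, h⟩
    · rw [List.length_ofFn]
      exact formL_formToks (fun i l h => by cases h; simp) φ
    · rw [sat_formToks_enc]
      simp only [key]
      exact (realize_codedDoubles P φ a).1 h

end Coded

section Consistency

open Filter

theorem typeConsistent_of_eventually {L : FirstOrder.Language.{0, 0}} {M : CodedStructure L}
    (hM : M.carrier.Nonempty) {n : ℕ} {p : Set (ParamFormula L M n)} (a : ℕ → Fin n → M.carrier)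
    (h : ∀ q ∈ p, ∀ᶠ s in atTop,
      @Formula.Realize L M.carrier M.struc _ q.2.1 (Sum.elim (a s) q.2.2)) :
    TypeConsistent M p := by
  let := M.struc
  have : Nonempty M.carrier := hM.to_subtype
  let U : Ultrafilter ℕ := hyperfilter ℕ
  have hU : (U : Filter ℕ) ≤ atTop := by
    rw [← Nat.cofinite_eq_atTop]
    exact hyperfilter_le_cofinite
  let c : (ℕ → M.carrier) → (U : Filter ℕ).Product fun _ => M.carrier := fun x =>
    Quotient.mk ((U : Filter ℕ).productSetoid fun _ => M.carrier) x
  let j : M.carrier ↪ₑ[L] (U : Filter ℕ).Product fun _ => M.carrier :=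
    { toFun := fun x => c fun _ => x
      map_formula' := fun {k} φ x => by
        exact (Ultraproduct.realize_formula_cast (u := U) φ fun i (_ : ℕ) => x i).trans
          eventually_const }
  refine ⟨(U : Filter ℕ).Product fun _ => M.carrier, inferInstance, j,
    fun i => c fun s => a s i, fun q hq => ?_⟩
  have key := (Ultraproduct.realize_formula_cast (u := U) (M := fun _ => M.carrier) q.2.1
    (Sum.elim (fun i s => a s i) fun i _ => q.2.2 i)).2 (hU ((h q hq).mono fun s hs => by
      convert hs using 1
      ext (i | i) <;> rfl))
  have e : (Sum.elim (fun i => c fun s => a s i) fun i => j (q.2.2 i)) =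
      fun i => c (Sum.elim (fun i s => a s i) (fun i _ => q.2.2 i) i) := by
    funext i
    rcases i with i | i <;> rfl
  exact (congrArg (Formula.Realize q.2.1) e).mpr key

end Consistency

section Isolation

open Encodable

variable {L : FirstOrder.Language.{0, 0}} {g : GoedelCoding L} [L.Structure ℕ] {α : Type}

variable (L) in
/-- A tuple whose complete type over the empty set is isolated. -/
def Isolated (a : α → ℕ) : Prop :=
  ∃ θ : L.Formula α, θ.Realize a ∧
    ∀ b : α → ℕ, θ.Realize b → ∀ ψ : L.Formula α, ψ.Realize a ↔ ψ.Realize b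

theorem exists_deciding (χ : L.Formula α) (hχ : ∃ a : α → ℕ, χ.Realize a) (ρ : L.Formula α) :
    ∃ χ' : L.Formula α, (∃ a : α → ℕ, χ'.Realize a) ∧ (∀ a : α → ℕ, χ'.Realize a → χ.Realize a) ∧
      ((∀ a : α → ℕ, χ'.Realize a → ρ.Realize a) ∨ ∀ a : α → ℕ, χ'.Realize a → ¬ρ.Realize a) := by
  obtain ⟨a, ha⟩ := hχ
  by_cases h : ρ.Realize a
  · exact ⟨χ ⊓ ρ, ⟨a, Formula.realize_inf.2 ⟨ha, h⟩⟩, fun b hb => (Formula.realize_inf.1 hb).1,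
      Or.inl fun b hb => (Formula.realize_inf.1 hb).2⟩
  · exact ⟨χ ⊓ ρ.not, ⟨a, Formula.realize_inf.2 ⟨ha, Formula.realize_not.2 h⟩⟩,
      fun b hb => (Formula.realize_inf.1 hb).1,
      Or.inr fun b hb => Formula.realize_not.1 (Formula.realize_inf.1 hb).2⟩

theorem exists_refinement {φ χ : L.Formula α} (hφ : ∀ a : α → ℕ, φ.Realize a → ¬Isolated L a)
    (hχ : ∃ a : α → ℕ, χ.Realize a) (h : ∀ a : α → ℕ, χ.Realize a → φ.Realize a)
    (ρ : L.Formula α) (Y : L.Formula α → Prop) :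
    ∃ χ' : L.Formula α, (∃ a : α → ℕ, χ'.Realize a) ∧ (∀ a : α → ℕ, χ'.Realize a → χ.Realize a) ∧
      ((∀ a : α → ℕ, χ'.Realize a → ρ.Realize a) ∨ ∀ a : α → ℕ, χ'.Realize a → ¬ρ.Realize a) ∧
      ∃ ψ : L.Formula α, ∀ a : α → ℕ, χ'.Realize a → (ψ.Realize a ↔ ¬Y ψ) := by
  obtain ⟨χ₁, ⟨a, ha⟩, h₁, hρ⟩ := exists_deciding χ hχ ρ
  have : ∃ b : α → ℕ, χ₁.Realize b ∧ ∃ ψ : L.Formula α, ¬(ψ.Realize a ↔ ψ.Realize b) := by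
    by_contra! hc
    exact hφ a (h a (h₁ a ha)) ⟨χ₁, ha, fun b hb ψ => hc b hb ψ⟩
  obtain ⟨b, hb, ψ, hψ⟩ := this
  have main : ∀ χ₂ : L.Formula α, (∃ c : α → ℕ, χ₁.Realize c ∧ χ₂.Realize c) →
      (∀ c : α → ℕ, χ₂.Realize c → (ψ.Realize c ↔ ¬Y ψ)) →
      ∃ χ' : L.Formula α, (∃ a : α → ℕ, χ'.Realize a) ∧
        (∀ a : α → ℕ, χ'.Realize a → χ.Realize a) ∧
        ((∀ a : α → ℕ, χ'.Realize a → ρ.Realize a) ∨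
          ∀ a : α → ℕ, χ'.Realize a → ¬ρ.Realize a) ∧
        ∃ ψ : L.Formula α, ∀ a : α → ℕ, χ'.Realize a → (ψ.Realize a ↔ ¬Y ψ) := by
    rintro χ₂ ⟨c, hc₁, hc₂⟩ h₂
    have hinf : ∀ a : α → ℕ, (χ₁ ⊓ χ₂).Realize a → χ₁.Realize a ∧ χ₂.Realize a :=
      fun a => Formula.realize_inf.1
    exact ⟨χ₁ ⊓ χ₂, ⟨c, Formula.realize_inf.2 ⟨hc₁, hc₂⟩⟩, fun a ha => h₁ a (hinf a ha).1,
      hρ.imp (fun hρ a ha => hρ a (hinf a ha).1) (fun hρ a ha => hρ a (hinf a ha).1),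
      ψ, fun a ha => h₂ a (hinf a ha).2⟩
  by_cases hY : Y ψ
  · refine main ψ.not ?_ fun c hc => by simpa [hY, Formula.realize_not] using hc
    simp only [Formula.realize_not]
    by_cases hψa : ψ.Realize a
    · exact ⟨b, hb, fun hψb => hψ ⟨fun _ => hψb, fun _ => hψa⟩⟩
    · exact ⟨a, ha, hψa⟩
  · refine main ψ ?_ fun c hc => by simpa [hY] using hc
    by_cases hψa : ψ.Realize a
    · exact ⟨a, ha, hψa⟩
    · by_cases hψb : ψ.Realize b
      · exact ⟨b, hb, hψb⟩
      · exact absurd ⟨fun h => absurd h hψa, fun h => absurd h hψb⟩ hψ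

/-- A sequence of formulas describing a complete type. -/
structure IsTypeSequence (χ : ℕ → L.Formula α) : Prop where
  realized : ∀ s, ∃ a : α → ℕ, (χ s).Realize a
  succ_le : ∀ s (a : α → ℕ), (χ (s + 1)).Realize a → (χ s).Realize a
  decides : ∀ ψ : L.Formula α, ∃ s, (∀ a : α → ℕ, (χ s).Realize a → ψ.Realize a) ∨
    ∀ a : α → ℕ, (χ s).Realize a → ¬ψ.Realize a

theorem IsTypeSequence.mono {χ : ℕ → L.Formula α} (h : IsTypeSequence χ) {s t : ℕ} (hst : s ≤ t)
    (a : α → ℕ) (ha : (χ t).Realize a) : (χ s).Realize a := by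
  induction t, hst using Nat.le_induction with
  | base => exact ha
  | succ t _ ih => exact ih (h.succ_le t a ha)

/-- The type described by a sequence of formulas. -/
def typeOf {n : ℕ} (χ : ℕ → L.Formula (Fin n ⊕ Fin 0)) (P : L.ElementarySubstructure ℕ) :
    Set (ParamFormula L (codedDoubles P) n) :=
  {q | ∃ ψ : L.Formula (Fin n ⊕ Fin 0), q = ⟨0, ψ, Fin.elim0⟩ ∧
    ∃ s, ∀ b : Fin n ⊕ Fin 0 → ℕ, (χ s).Realize b → ψ.Realize b}

theorem isNType_typeOf {n : ℕ} {χ : ℕ → L.Formula (Fin n ⊕ Fin 0)} (h : IsTypeSequence χ) :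
    IsNType (codedDoubles (⊤ : L.ElementarySubstructure ℕ)) ∅ n (typeOf χ ⊤) := by
  refine ⟨?_, ?_, ?_⟩
  · rintro q ⟨ψ, rfl, -⟩ i
    exact i.elim0
  · choose a ha using h.realized
    refine typeConsistent_of_eventually (M := codedDoubles ⊤) ⟨2 * 0, 0, trivial, rfl⟩
      (fun s i => ⟨2 * a s (Sum.inl i), a s (Sum.inl i), trivial, rfl⟩) ?_
    rintro q ⟨ψ, rfl, s, hs⟩
    filter_upwards [Filter.eventually_ge_atTop s] with t ht
    refine (realize_codedDoubles ⊤ ψ _).2 ?_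
    convert hs _ (h.mono ht _ (ha t)) using 1
    ext (i | i)
    · simp
    · exact i.elim0
  · rintro ⟨k, ψ, x⟩ hx hq ⟨N, SN, j, b, hb⟩
    obtain rfl : k = 0 := by
      by_contra hk
      exact hx ⟨0, Nat.pos_of_ne_zero hk⟩
    obtain rfl : x = Fin.elim0 := Subsingleton.elim _ _
    obtain ⟨s, hs | hs⟩ := h.decides ψ
    · exact hq ⟨ψ, rfl, s, hs⟩
    · have h₁ := hb _ (Set.mem_insert _ _)
      have h₂ := hb ⟨0, ψ.not, Fin.elim0⟩ (Set.mem_insert_of_mem _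
        ⟨_, rfl, s, fun b hb => Formula.realize_not.2 (hs b hb)⟩)
      exact Formula.realize_not.1 h₂ h₁

end Isolation

section Density

open Encodable

variable {L : FirstOrder.Language.{0, 0}} {g : GoedelCoding L} [L.Structure ℕ] {α : Type}

theorem exists_env [Finite α] {enc : α → ℕ} (h : Function.Injective enc) (a : α → ℕ) :
    ∃ v : List ℕ, (fun i => v.getD (enc i) 0) = a := by
  obtain ⟨m, hm⟩ := (Set.finite_range enc).bddAbove
  refine ⟨(List.range (m + 1)).map (Function.extend enc a 0), funext fun i => ?_⟩
  have : enc i < m + 1 := Nat.lt_succ_of_le (hm ⟨i, rfl⟩)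
  simp [List.getD, this, h.extend_apply]

theorem forall_env_iff [Finite α] {enc : α → ℕ} (h : Function.Injective enc)
    {p : (α → ℕ) → Prop} : (∀ v : List ℕ, p fun i => v.getD (enc i) 0) ↔ ∀ a, p a := by
  refine ⟨fun hp a => ?_, fun hp v => hp _⟩
  obtain ⟨v, rfl⟩ := exists_env h a
  exact hp v

theorem exists_env_iff [Finite α] {enc : α → ℕ} (h : Function.Injective enc)
    {p : (α → ℕ) → Prop} : (∃ v : List ℕ, p fun i => v.getD (enc i) 0) ↔ ∃ a, p a := by
  refine ⟨fun ⟨v, hv⟩ => ⟨_, hv⟩, fun ⟨a, ha⟩ => ?_⟩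
  obtain ⟨v, rfl⟩ := exists_env h a
  exact ⟨v, ha⟩

theorem exists_arith_typeSequence (hL : ArithLang g)
    (hS : Arith fun x : List ℕ × List ℕ => Sat g x.1 x.2) [Finite α] {enc : α → ℕ}
    (henc : Function.Injective enc) {vs : List ℕ} (hvs : ∀ c, c ∈ vs ↔ ∃ a, enc a = c)
    {φ : L.Formula α} (hφ : ∃ a : α → ℕ, φ.Realize a)
    (hni : ∀ a : α → ℕ, φ.Realize a → ¬Isolated L a)
    {Y : ℕ → List ℕ → Prop} (hY : Arith fun x : ℕ × List ℕ => Y x.1 x.2) :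
    ∃ χ : ℕ → L.Formula α, IsTypeSequence χ ∧ (Arith fun s => formToks g enc (χ s)) ∧
      ∀ s, ∃ ψ : L.Formula α, ∀ a : α → ℕ, (χ (s + 1)).Realize a →
        (ψ.Realize a ↔ ¬Y s (formToks g enc ψ)) := by
  classical
  have hF : Arith fun l : List ℕ => FormL g (some vs) 0 l :=
    hL.formL.comp (f := fun l : List ℕ => (some vs, 0, l)) (by fun_prop)
  generalize hFL : (fun l : List ℕ => FormL g (some vs) 0 l) = FL at hF
  have hFL' : ∀ l, FL l ↔ ∃ ψ : L.Formula α, l = formToks g enc ψ := by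
    intro l
    rw [← hFL]
    constructor
    · exact fun h => h.exists_formula fun c hc => (hvs c).1 (hc _ rfl)
    · rintro ⟨ψ, rfl⟩
      exact formL_formToks (fun a l h => by cases h; exact (hvs _).2 ⟨a, rfl⟩) ψ
  obtain ⟨f, hf, h₀, hs⟩ := exists_arith_seq (α := List ℕ)
    (R := fun s l l' => (∀ v, Sat g l' v → Sat g l v) ∧
      (∀ q, FL q → s = encode q → (∀ v, Sat g l' v → Sat g q v) ∨ ∀ v, Sat g l' v → ¬Sat g q v) ∧
      ∃ q, FL q ∧ ∀ v, Sat g l' v → (Sat g q v ↔ ¬Y s q))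
    (P := fun _ l => FL l ∧ (∃ v, Sat g l v) ∧ ∀ v, Sat g l v → Sat g (formToks g enc φ) v)
    (by fun_prop) (by fun_prop) (formToks g enc φ)
    ⟨(hFL' _).2 ⟨φ, rfl⟩, by
      simp only [sat_formToks_enc]
      exact (exists_env_iff henc (p := fun a => φ.Realize a)).2 hφ, fun _ h => h⟩ (by
    rintro s l ⟨hl, hr, hi⟩
    obtain ⟨χ, rfl⟩ := (hFL' l).1 hl
    simp only [sat_formToks_enc] at hr hi
    rw [exists_env_iff henc (p := fun a => χ.Realize a)] at hr
    rw [forall_env_iff henc (p := fun a => χ.Realize a → φ.Realize a)] at hi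
    obtain ⟨ρ, hρ⟩ : ∃ ρ : L.Formula α, ∀ ψ : L.Formula α,
        s = encode (formToks g enc ψ) → ψ = ρ := by
      by_cases h : ∃ ρ : L.Formula α, s = encode (formToks g enc ρ)
      · obtain ⟨ρ, hρ⟩ := h
        exact ⟨ρ, fun ψ hψ => formToks_injective g henc (encode_injective (hψ.symm.trans hρ))⟩
      · exact ⟨⊤, fun ψ hψ => absurd ⟨ψ, hψ⟩ h⟩
    obtain ⟨χ', h₁, h₂, h₃, ψ, h₄⟩ := exists_refinement hni hr hi ρ fun ψ => Y s (formToks g enc ψ)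
    refine ⟨formToks g enc χ', ⟨?_, ?_, formToks g enc ψ, (hFL' _).2 ⟨ψ, rfl⟩, ?_⟩,
      (hFL' _).2 ⟨χ', rfl⟩, ?_, ?_⟩
    · simp only [sat_formToks_enc]
      exact fun v => h₂ _
    · intro q hq hqs
      obtain ⟨ψ, rfl⟩ := (hFL' q).1 hq
      simp only [sat_formToks_enc]
      rw [hρ ψ hqs]
      exact h₃.imp (fun h v => h _) fun h v => h _
    · simp only [sat_formToks_enc]
      exact fun v => h₄ _
    · simp only [sat_formToks_enc]
      exact (exists_env_iff henc (p := fun a => χ'.Realize a)).2 h₁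
    · simp only [sat_formToks_enc]
      exact fun v hv => hi _ (h₂ _ hv))
  choose χ hχ using fun s => (hFL' (f s)).1 (hs s).1.1
  simp only [hχ, sat_formToks_enc] at hs
  refine ⟨χ, ⟨fun s => ?_, fun s => ?_, fun ψ => ⟨encode (formToks g enc ψ) + 1, ?_⟩⟩, ?_,
    fun s => ?_⟩
  · exact (exists_env_iff henc (p := fun a => (χ s).Realize a)).1 (hs s).1.2.1
  · exact (forall_env_iff henc (p := fun a => (χ (s + 1)).Realize a → (χ s).Realize a)).1 (hs s).2.1
  · have := (hs _).2.2.1 (formToks g enc ψ) ((hFL' _).2 ⟨ψ, rfl⟩) rfl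
    simp only [sat_formToks_enc] at this
    exact this.imp (forall_env_iff henc (p := fun a => (χ _).Realize a → ψ.Realize a)).1
      (forall_env_iff henc (p := fun a => (χ _).Realize a → ¬ψ.Realize a)).1
  · exact Arith.congr hf hχ
  · obtain ⟨q, hq, h⟩ := (hs s).2.2.2
    obtain ⟨ψ, rfl⟩ := (hFL' q).1 hq
    simp only [sat_formToks_enc] at h
    exact ⟨ψ, (forall_env_iff henc (p := fun a => (χ (s + 1)).Realize a →
      (ψ.Realize a ↔ ¬Y s (formToks g enc ψ)))).1 h⟩

/-- The coding of variables used for types over the empty set. -/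
def typeEnc (n : ℕ) : Fin n ⊕ Fin 0 → ℕ :=
  Sum.elim (fun i => Nat.pair 0 i) fun j => Nat.pair 1 j

theorem typeEnc_injective (n : ℕ) : Function.Injective (typeEnc n) := by
  rintro (i | i) (j | j) h
  · exact congrArg Sum.inl (Fin.ext (Nat.pair_eq_pair.1 h).2)
  · exact j.elim0
  · exact i.elim0
  · exact i.elim0

theorem mem_typeVars {n : ℕ} (c : ℕ) :
    c ∈ (List.range n).map (Nat.pair 0) ↔ ∃ a, typeEnc n a = c := by
  simp only [List.mem_map, List.mem_range, Sum.exists, typeEnc, Sum.elim_inl, IsEmpty.exists_iff,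
    or_false]
  exact ⟨fun ⟨i, hi, h⟩ => ⟨⟨i, hi⟩, h⟩, fun ⟨i, h⟩ => ⟨i, i.2, h⟩⟩

theorem mem_typeCode_typeOf {n : ℕ} {χ : ℕ → L.Formula (Fin n ⊕ Fin 0)}
    {P : L.ElementarySubstructure ℕ} {c : ℕ} :
    c ∈ typeCode g (typeOf χ P) ↔ ∃ ψ : L.Formula (Fin n ⊕ Fin 0),
      c = Nat.pair (Nat.pair 0 (encode (formToks g (typeEnc n) ψ))) (encode ([] : List ℕ)) ∧
        ∃ s, ∀ b : Fin n ⊕ Fin 0 → ℕ, (χ s).Realize b → ψ.Realize b := by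
  constructor
  · rintro ⟨_, ⟨ψ, rfl, h⟩, rfl⟩
    exact ⟨ψ, rfl, h⟩
  · rintro ⟨ψ, rfl, h⟩
    exact ⟨_, ⟨ψ, rfl, h⟩, rfl⟩

theorem arith_mem_typeCode (hL : ArithLang g)
    (hS : Arith fun x : List ℕ × List ℕ => Sat g x.1 x.2) {n : ℕ}
    {χ : ℕ → L.Formula (Fin n ⊕ Fin 0)} (hχ : Arith fun s => formToks g (typeEnc n) (χ s))
    {P : L.ElementarySubstructure ℕ} : Arith fun c => c ∈ typeCode g (typeOf χ P) := by
  have hF : Arith fun l : List ℕ => FormL g (some ((List.range n).map (Nat.pair 0))) 0 l :=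
    hL.formL.comp (f := fun l : List ℕ => (some ((List.range n).map (Nat.pair 0)), 0, l))
      (by fun_prop)
  generalize hFL : (fun l : List ℕ => FormL g (some ((List.range n).map (Nat.pair 0))) 0 l) = FL
    at hF
  generalize hf : (fun s => formToks g (typeEnc n) (χ s)) = f at hχ
  have key : ∀ ψ : L.Formula (Fin n ⊕ Fin 0), (∃ s, ∀ v, Sat g (f s) v →
      Sat g (formToks g (typeEnc n) ψ) v) ↔
        ∃ s, ∀ b : Fin n ⊕ Fin 0 → ℕ, (χ s).Realize b → ψ.Realize b := by
    intro ψ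
    subst hf
    simp only [sat_formToks_enc]
    exact exists_congr fun s => forall_env_iff (typeEnc_injective n)
      (p := fun b => (χ s).Realize b → ψ.Realize b)
  refine Arith.congr (f := fun c => ∃ l : List ℕ, FL l ∧
    c = Nat.pair (Nat.pair 0 (encode l)) (encode ([] : List ℕ)) ∧
      ∃ s, ∀ v, Sat g (f s) v → Sat g l v) (by fun_prop) fun c => propext ?_
  rw [mem_typeCode_typeOf]
  constructor
  · rintro ⟨l, hl, rfl, h⟩
    rw [← hFL] at hl
    obtain ⟨ψ, rfl⟩ := hl.exists_formula (enc := typeEnc n) fun c hc =>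
      (mem_typeVars c).1 (hc _ rfl)
    exact ⟨ψ, rfl, (key ψ).1 h⟩
  · rintro ⟨ψ, rfl, h⟩
    refine ⟨_, ?_, rfl, (key ψ).2 h⟩
    rw [← hFL]
    exact formL_formToks (fun a l h => by cases h; exact (mem_typeVars _).2 ⟨a, rfl⟩) ψ

theorem exists_isolated_sum (hL : ArithLang g)
    (hS : Arith fun x : List ℕ × List ℕ => Sat g x.1 x.2) {T : L.Theory}
    (hT : ∀ φ ∈ T, Sentence.Realize ℕ φ) (hst : ArithStable g T) {n : ℕ} (hn : 1 ≤ n)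
    (φ : L.Formula (Fin n ⊕ Fin 0)) (hφ : ∃ a : Fin n ⊕ Fin 0 → ℕ, φ.Realize a) :
    ∃ a : Fin n ⊕ Fin 0 → ℕ, φ.Realize a ∧ Isolated L a := by
  by_contra! hni
  obtain ⟨X, hX, -, hX'⟩ := hst (codedDoubles ⊤)
    (arithDecidable_codedDoubles hL hS ⊤ (Arith.congr (f := fun _ => True) (by fun_prop)
      fun i => propext ⟨fun _ => trivial, fun _ => trivial⟩)) (models_codedDoubles hT ⊤) ∅
    (Set.empty_subset _) (isArithmetical_iff_arith.2 (Arith.congr (f := fun _ => False)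
      (by fun_prop) fun i => propext ⟨False.elim, False.elim⟩))
  rw [isArithmetical_iff_arith] at hX
  generalize hXm : (fun n => n ∈ X) = Xm at hX
  have hXm' : ∀ m, m ∈ X ↔ Xm m := fun m => by rw [← hXm]
  let Y : ℕ → List ℕ → Prop := fun s l =>
    Xm (Nat.pair n (Nat.pair s (Nat.pair (Nat.pair 0 (encode l)) (encode ([] : List ℕ)))))
  obtain ⟨χ, hχ, hχa, hdiag⟩ := exists_arith_typeSequence (Y := Y)
    (vs := (List.range n).map (Nat.pair 0)) hL hS (typeEnc_injective n) mem_typeVars hφ hni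
    (by fun_prop)
  obtain ⟨i, hi⟩ := hX' n hn _ (isNType_typeOf hχ) (isArithmetical_iff_arith.2
    (arith_mem_typeCode hL hS hχa))
  obtain ⟨ψ, hψ⟩ := hdiag i
  have hmem : Y i (formToks g (typeEnc n) ψ) ↔
      ∃ s, ∀ b : Fin n ⊕ Fin 0 → ℕ, (χ s).Realize b → ψ.Realize b := by
    have h₁ := Set.ext_iff.1 hi
      (Nat.pair (Nat.pair 0 (encode (formToks g (typeEnc n) ψ))) (encode ([] : List ℕ)))
    rw [mem_typeCode_typeOf] at h₁
    refine (hXm' _).symm.trans (h₁.trans ⟨?_, fun h => ⟨ψ, rfl, h⟩⟩)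
    rintro ⟨ψ', h, h'⟩
    obtain rfl : ψ = ψ' := formToks_injective g (typeEnc_injective n) (encode_injective
      (Nat.pair_eq_pair.1 (Nat.pair_eq_pair.1 h).1).2)
    exact h'
  by_cases hY : Y i (formToks g (typeEnc n) ψ)
  · obtain ⟨s, hs⟩ := hmem.1 hY
    obtain ⟨a, ha⟩ := hχ.realized (max s (i + 1))
    exact (hψ a (hχ.mono (le_max_right _ _) a ha)).1 (hs a (hχ.mono (le_max_left _ _) a ha)) hY
  · exact hY (hmem.2 ⟨i + 1, fun b hb => (hψ b hb).2 hY⟩)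

end Density

section Atomic

open Encodable

variable {L : FirstOrder.Language.{0, 0}} {g : GoedelCoding L}

/-- The formula `∃ x, φ` where `x` is the last variable of `φ`. -/
noncomputable def exLast {n : ℕ} (φ : L.Formula (Fin (n + 1))) : L.Formula (Fin n) :=
  (φ.relabel (Fin.lastCases (Sum.inr ()) Sum.inl : Fin (n + 1) → Fin n ⊕ Unit)).iExs Unit

theorem realize_exLast {M : Type} [L.Structure M] {n : ℕ} {φ : L.Formula (Fin (n + 1))}
    {v : Fin n → M} :
    (exLast φ).Realize v ↔ ∃ x, φ.Realize (Fin.snoc v x : Fin (n + 1) → M) := by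
  have h : ∀ w : Unit → M, (Sum.elim v w ∘ Fin.lastCases (Sum.inr ()) Sum.inl :
      Fin (n + 1) → M) = Fin.snoc v (w ()) := by
    intro w
    funext i
    refine Fin.lastCases ?_ (fun i => ?_) i <;> simp
  rw [exLast, Formula.realize_iExs]
  simp only [Formula.realize_relabel, h]
  exact ⟨fun ⟨w, hw⟩ => ⟨_, hw⟩, fun ⟨x, hx⟩ => ⟨fun _ => x, hx⟩⟩

variable [L.Structure ℕ]

theorem Isolated.comp_equiv {α β : Type} {a : α → ℕ} (h : Isolated L a) (e : α ≃ β) :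
    Isolated L (a ∘ e.symm) := by
  obtain ⟨θ, hθ, h⟩ := h
  have ha : (a ∘ e.symm) ∘ e = a := by
    funext i
    simp
  refine ⟨θ.relabel e, Formula.realize_relabel.2 (by rwa [ha]), fun b hb ψ => ?_⟩
  have := h _ (Formula.realize_relabel.1 hb) (ψ.relabel e.symm)
  rw [Formula.realize_relabel, Formula.realize_relabel] at this
  refine this.trans ?_
  rw [Function.comp_assoc, e.self_comp_symm, Function.comp_id]

theorem exists_isolated (hL : ArithLang g)
    (hS : Arith fun x : List ℕ × List ℕ => Sat g x.1 x.2) {T : L.Theory}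
    (hT : ∀ φ ∈ T, Sentence.Realize ℕ φ) (hst : ArithStable g T) {n : ℕ}
    (φ : L.Formula (Fin (n + 1))) (hφ : ∃ a : Fin (n + 1) → ℕ, φ.Realize a) :
    ∃ a : Fin (n + 1) → ℕ, φ.Realize a ∧ Isolated L a := by
  let e : Fin (n + 1) ⊕ Fin 0 ≃ Fin (n + 1) := Equiv.sumEmpty _ _
  obtain ⟨a, ha⟩ := hφ
  obtain ⟨b, hb, hi⟩ := exists_isolated_sum hL hS hT hst (Nat.le_add_left 1 n)
    (φ.relabel e.symm) ⟨a ∘ e, Formula.realize_relabel.2 (by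
      rwa [Function.comp_assoc, e.self_comp_symm, Function.comp_id])⟩
  exact ⟨b ∘ e.symm, Formula.realize_relabel.1 hb, hi.comp_equiv e⟩

theorem Isolated.exists_snoc {n : ℕ} (hd : ∀ φ : L.Formula (Fin (n + 1)),
      (∃ a : Fin (n + 1) → ℕ, φ.Realize a) → ∃ a : Fin (n + 1) → ℕ, φ.Realize a ∧ Isolated L a)
    {a : Fin n → ℕ} (h : Isolated L a) {φ : L.Formula (Fin (n + 1))}
    (hφ : ∃ x, φ.Realize (Fin.snoc a x : Fin (n + 1) → ℕ)) :
    ∃ x, φ.Realize (Fin.snoc a x : Fin (n + 1) → ℕ) ∧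
      Isolated L (Fin.snoc a x : Fin (n + 1) → ℕ) := by
  obtain ⟨θ, hθ, h⟩ := h
  obtain ⟨x, hx⟩ := hφ
  have hcs : ∀ (b : Fin n → ℕ) (y : ℕ), (Fin.snoc b y : Fin (n + 1) → ℕ) ∘ Fin.castSucc = b := by
    intro b y
    funext i
    simp
  obtain ⟨d, hd, θ', hθ', h'⟩ := hd (θ.relabel Fin.castSucc ⊓ φ)
    ⟨Fin.snoc a x, Formula.realize_inf.2 ⟨Formula.realize_relabel.2 (by rwa [hcs]), hx⟩⟩
  rw [Formula.realize_inf, Formula.realize_relabel] at hd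
  have hsn : (Fin.snoc (d ∘ Fin.castSucc) (d (Fin.last n)) : Fin (n + 1) → ℕ) = d :=
    Fin.snoc_init_self d
  have := (h _ hd.1 (exLast (φ ⊓ θ'))).2 (realize_exLast.2 ⟨d (Fin.last n), by
    rw [hsn]
    exact Formula.realize_inf.2 ⟨hd.2, hθ'⟩⟩)
  obtain ⟨y, hy⟩ := realize_exLast.1 this
  rw [Formula.realize_inf] at hy
  exact ⟨y, hy.1, θ', hy.2, fun b hb ψ => (h' _ hy.2 ψ).symm.trans (h' b hb ψ)⟩

/-- A sequence of elements, all of whose initial segments are isolated, satisfying the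
Tarski-Vaught criterion. -/
structure IsAtomicSequence (L : FirstOrder.Language.{0, 0}) [L.Structure ℕ] (c : ℕ → ℕ) : Prop where
  isolated : ∀ s, Isolated L fun i : Fin s => c i
  exists_realize : ∀ {k : ℕ} (φ : L.Formula (Fin (k + 1))) (j : Fin k → ℕ),
    (∃ x, φ.Realize (Fin.snoc (fun i => c (j i)) x : Fin (k + 1) → ℕ)) →
      ∃ i, φ.Realize (Fin.snoc (fun i => c (j i)) (c i) : Fin (k + 1) → ℕ)

namespace IsAtomicSequence

variable {c : ℕ → ℕ}

/-- The elementary substructure enumerated by an atomic sequence. -/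
def toElementarySubstructure (h : IsAtomicSequence L c) : L.ElementarySubstructure ℕ :=
  Substructure.toElementarySubstructure
    { carrier := Set.range c
      fun_mem := fun {n} f x hx => by
        choose j hj using hx
        let φ : L.Formula (Fin (n + 1)) := Term.equal
          (Term.func f fun i => Term.var i.castSucc) (Term.var (Fin.last n))
        have hφ : ∀ y, φ.Realize (Fin.snoc (fun i => c (j i)) y : Fin (n + 1) → ℕ) ↔
            Structure.funMap f x = y := fun y => by
          simp [φ, Formula.realize_equal, hj]
        obtain ⟨i, hi⟩ := h.exists_realize φ j ⟨_, (hφ _).2 rfl⟩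
        exact ⟨i, ((hφ _).1 hi).symm⟩ }
    (fun n φ x a ha => by
      choose j hj using fun i => (x i).2
      have hφ : ∀ (e : Empty → ℕ) (v : Fin (n + 1) → ℕ),
          (φ.toFormula.relabel (Sum.elim Empty.elim id)).Realize v ↔ φ.Realize e v := by
        intro e v
        rw [Formula.realize_relabel, BoundedFormula.realize_toFormula]
        exact iff_of_eq (congrArg₂ _ (Subsingleton.elim _ _) rfl)
      have hx : ((↑) ∘ x : Fin n → ℕ) = fun i => c (j i) := funext fun i => (hj i).symm
      rw [hx] at ha ⊢
      obtain ⟨i, hi⟩ := h.exists_realize _ j ⟨a, (hφ _ _).2 ha⟩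
      exact ⟨⟨c i, i, rfl⟩, (hφ _ _).1 hi⟩)

theorem mem_toElementarySubstructure (h : IsAtomicSequence L c) {x : ℕ} :
    x ∈ h.toElementarySubstructure ↔ ∃ i, c i = x := Iff.rfl

variable {N : Type} [L.Structure N]

theorem exists_next (h : IsAtomicSequence L c)
    (hN : ∀ {k : ℕ} (φ : L.Formula (Fin k)), (∀ a : Fin k → ℕ, φ.Realize a) →
      ∀ a : Fin k → N, φ.Realize a) {s : ℕ} {d : Fin s → N}
    (hd : ∀ ψ : L.Formula (Fin s), ψ.Realize (fun i : Fin s => c i) → ψ.Realize d) :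
    ∃ y, ∀ ψ : L.Formula (Fin (s + 1)), ψ.Realize (fun i : Fin (s + 1) => c i) →
      ψ.Realize (Fin.snoc d y : Fin (s + 1) → N) := by
  obtain ⟨θ, hθ, hi⟩ := h.isolated (s + 1)
  obtain ⟨y, hy⟩ := realize_exLast.1 (hd (exLast θ) (realize_exLast.2 ⟨c s, by
    convert hθ using 1
    funext i
    refine Fin.lastCases ?_ (fun i => ?_) i <;> simp⟩))
  exact ⟨y, fun ψ hψ => Formula.realize_imp.1
    (hN (θ.imp ψ) (fun b => Formula.realize_imp.2 fun hb => (hi b hb ψ).1 hψ) _) hy⟩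

theorem exists_images [Nonempty N] (h : IsAtomicSequence L c)
    (hN : ∀ {k : ℕ} (φ : L.Formula (Fin k)), (∀ a : Fin k → ℕ, φ.Realize a) →
      ∀ a : Fin k → N, φ.Realize a) :
    ∃ d : ℕ → N, ∀ (s : ℕ) (ψ : L.Formula (Fin s)), ψ.Realize (fun i : Fin s => c i) →
      ψ.Realize fun i : Fin s => d i := by
  classical
  let E : ℕ → (ℕ → N) → Prop := fun s d => ∀ ψ : L.Formula (Fin s),
    ψ.Realize (fun i : Fin s => c i) → ψ.Realize fun i : Fin s => d i
  have hstep : ∀ s d, E s d → ∃ y, E (s + 1) (Function.update d s y) := by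
    intro s d hd
    obtain ⟨y, hy⟩ := h.exists_next hN hd
    refine ⟨y, fun ψ hψ => ?_⟩
    convert hy ψ hψ using 1
    funext i
    refine Fin.lastCases ?_ (fun i => ?_) i
    · simp
    · simp [i.2.ne]
  choose! y hy using hstep
  let D : ℕ → ℕ → N := fun s => Nat.rec (fun _ => Classical.arbitrary N)
    (fun s d => Function.update d s (y s d)) s
  have hD : ∀ s, D (s + 1) = Function.update (D s) s (y s (D s)) := fun s => rfl
  have hE : ∀ s, E s (D s) := by
    intro s
    induction s with
    | zero => exact fun ψ hψ => hN ψ (fun a => by rwa [Subsingleton.elim a]) _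
    | succ s ih => exact hD s ▸ hy s _ ih
  have hst : ∀ t s, t < s → D s t = D (t + 1) t := by
    intro t s hts
    induction s, hts using Nat.le_induction with
    | base => rfl
    | succ s hs ih => rw [hD, Function.update_of_ne (Nat.ne_of_lt hs), ih]
  refine ⟨fun t => D (t + 1) t, fun s ψ hψ => ?_⟩
  convert hE s ψ hψ using 1
  exact funext fun i => (hst i s i.2).symm

theorem nonempty_elementaryEmbedding [Nonempty N] (h : IsAtomicSequence L c)
    (hN : ∀ {k : ℕ} (φ : L.Formula (Fin k)), (∀ a : Fin k → ℕ, φ.Realize a) →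
      ∀ a : Fin k → N, φ.Realize a) :
    Nonempty (h.toElementarySubstructure ↪ₑ[L] N) := by
  obtain ⟨d, hd⟩ := h.exists_images hN
  have hd' : ∀ (s : ℕ) (ψ : L.Formula (Fin s)), ψ.Realize (fun i : Fin s => d i) ↔
      ψ.Realize fun i : Fin s => c i := by
    refine fun s ψ => ⟨fun h₁ => ?_, hd s ψ⟩
    by_contra h₂
    exact Formula.realize_not.1 (hd s ψ.not (Formula.realize_not.2 h₂)) h₁
  choose j hj using fun x : h.toElementarySubstructure => h.mem_toElementarySubstructure.1 x.2
  refine ⟨⟨fun x => d (j x), fun n φ x => ?_⟩⟩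
  obtain ⟨m, hm⟩ := (Set.finite_range fun i => j (x i)).bddAbove
  have hm' : ∀ i, j (x i) < m + 1 := fun i => Nat.lt_succ_of_le (hm ⟨i, rfl⟩)
  have key := hd' (m + 1) (φ.relabel fun i => ⟨j (x i), hm' i⟩)
  rw [Formula.realize_relabel, Formula.realize_relabel] at key
  refine key.trans ?_
  rw [← h.toElementarySubstructure.subtype.map_formula]
  refine iff_of_eq (congrArg _ (funext fun i => ?_))
  exact hj (x i)

end IsAtomicSequence

end Atomic

section Construction

open Encodable

variable {L : FirstOrder.Language.{0, 0}} {g : GoedelCoding L} [L.Structure ℕ]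

/-- Codes of formulas with free variables `0, …, n - 1`. -/
def FormN (g : GoedelCoding L) (n : ℕ) (l : List ℕ) : Prop := FormL g (some (List.range n)) 0 l

omit [L.Structure ℕ] in
theorem formN_iff {n : ℕ} {l : List ℕ} :
    FormN g n l ↔ ∃ φ : L.Formula (Fin n), l = formToks g Fin.val φ := by
  constructor
  · exact fun h => h.exists_formula fun c hc => ⟨⟨c, List.mem_range.1 (hc _ rfl)⟩, rfl⟩
  · rintro ⟨φ, rfl⟩
    exact formL_formToks (fun a l h => by cases h; exact List.mem_range.2 a.2) φ

omit [L.Structure ℕ] in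
theorem ArithLang.formN (hL : ArithLang g) : Arith fun x : ℕ × List ℕ => FormN g x.1 x.2 :=
  hL.formL.comp (f := fun x : ℕ × List ℕ => (some (List.range x.1), 0, x.2)) (by fun_prop)

theorem sat_ofFn {n : ℕ} {φ : L.Formula (Fin n)} {a : Fin n → ℕ} :
    Sat g (formToks g Fin.val φ) (List.ofFn a) ↔ φ.Realize a := by
  rw [sat_formToks_enc]
  refine iff_of_eq (congrArg _ (funext fun i => ?_))
  simp [List.getD]

/-- The list `a` enumerates an isolated tuple. -/
def IsolatedList (g : GoedelCoding L) (a : List ℕ) : Prop :=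
  ∃ l, FormN g a.length l ∧ Sat g l a ∧ ∀ b : List ℕ, b.length = a.length → Sat g l b →
    ∀ q, FormN g a.length q → (Sat g q a ↔ Sat g q b)

theorem isolatedList_ofFn {n : ℕ} {a : Fin n → ℕ} :
    IsolatedList g (List.ofFn a) ↔ Isolated L a := by
  rw [IsolatedList, List.length_ofFn]
  constructor
  · rintro ⟨l, hl, hs, h⟩
    obtain ⟨θ, rfl⟩ := formN_iff.1 hl
    refine ⟨θ, sat_ofFn.1 hs, fun b hb ψ => ?_⟩
    have := h (List.ofFn b) List.length_ofFn (sat_ofFn.2 hb) _ (formN_iff.2 ⟨ψ, rfl⟩)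
    rwa [sat_ofFn, sat_ofFn] at this
  · rintro ⟨θ, hθ, h⟩
    refine ⟨_, formN_iff.2 ⟨θ, rfl⟩, sat_ofFn.2 hθ, fun b hb hs q hq => ?_⟩
    obtain ⟨m, b, rfl⟩ := exists_eq_ofFn b
    obtain rfl : m = n := by simpa using hb
    obtain ⟨ψ, rfl⟩ := formN_iff.1 hq
    rw [sat_ofFn, sat_ofFn]
    exact h b (sat_ofFn.1 hs) ψ

theorem ofFn_append_singleton {n : ℕ} (a : Fin n → ℕ) (b : ℕ) :
    List.ofFn a ++ [b] = List.ofFn (Fin.snoc a b : Fin (n + 1) → ℕ) := by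
  rw [List.ofFn_succ', List.concat_eq_append]
  simp

theorem sat_select {n k : ℕ} {φ : L.Formula (Fin (k + 1))} {a : Fin n → ℕ} {j : Fin k → Fin n}
    {x : ℕ} :
    Sat g (formToks g Fin.val φ)
        ((List.ofFn fun i => (j i : ℕ)).map (fun i => (List.ofFn a).getD i 0) ++ [x]) ↔
      φ.Realize (Fin.snoc (fun i => a (j i)) x : Fin (k + 1) → ℕ) := by
  rw [← sat_ofFn (g := g), List.ofFn_succ', List.concat_eq_append]
  refine iff_of_eq (congrArg _ ?_)
  simp [List.getD, List.map_ofFn, Function.comp_def]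

theorem exists_atomicSequence (hL : ArithLang g)
    (hS : Arith fun x : List ℕ × List ℕ => Sat g x.1 x.2)
    (hd : ∀ {n : ℕ} (φ : L.Formula (Fin (n + 1))),
      (∃ a : Fin (n + 1) → ℕ, φ.Realize a) → ∃ a : Fin (n + 1) → ℕ, φ.Realize a ∧ Isolated L a) :
    ∃ c : ℕ → ℕ, Arith c ∧ IsAtomicSequence L c := by
  have hF := hL.formN
  have hI : Arith fun a : List ℕ => IsolatedList g a := by
    unfold IsolatedList
    fun_prop
  obtain ⟨f, hf, h₀, hs⟩ := exists_arith_seq (α := List ℕ)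
    (R := fun s a a' => ∃ b, a' = a ++ [b] ∧ ∀ l js : List ℕ,
      (Nat.unpair s).1 = Nat.pair (encode l) (encode js) → FormN g (js.length + 1) l →
      (∀ j, j ∈ js → j < a.length) → (∃ x, Sat g l (js.map (fun j => a.getD j 0) ++ [x])) →
        Sat g l (js.map (fun j => a.getD j 0) ++ [b]))
    (P := fun s a => a.length = s ∧ IsolatedList g a)
    (by fun_prop) (by fun_prop) []
    ⟨rfl, (isolatedList_ofFn (n := 0) (a := Fin.elim0)).2
      ⟨⊤, Formula.realize_top.2 trivial, fun b _ ψ => by rw [Subsingleton.elim b]⟩⟩ (by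
    rintro s a ⟨hla, ha⟩
    obtain ⟨n, a, rfl⟩ := exists_eq_ofFn a
    obtain rfl : n = s := by simpa using hla
    rw [isolatedList_ofFn] at ha
    by_cases htask : ∃ (k : ℕ) (φ : L.Formula (Fin (k + 1))) (j : Fin k → Fin n),
        (Nat.unpair n).1 = Nat.pair (encode (formToks g Fin.val φ))
          (encode (List.ofFn fun i => (j i : ℕ))) ∧
        ∃ x, φ.Realize (Fin.snoc (fun i => a (j i)) x : Fin (k + 1) → ℕ)
    · obtain ⟨k, φ, j, htask, hx⟩ := htask
      let e : Fin (k + 1) → Fin (n + 1) := Fin.snoc (fun i => (j i).castSucc) (Fin.last n)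
      have he : ∀ x, (Fin.snoc a x : Fin (n + 1) → ℕ) ∘ e = Fin.snoc (fun i => a (j i)) x := by
        intro x
        funext i
        refine Fin.lastCases ?_ (fun i => ?_) i <;> simp [e]
      obtain ⟨b, hb, hi⟩ := ha.exists_snoc hd (φ := φ.relabel e) (by
        simpa only [Formula.realize_relabel, he] using hx)
      rw [Formula.realize_relabel, he] at hb
      refine ⟨List.ofFn a ++ [b], ⟨b, rfl, ?_⟩, by simp, ?_⟩
      · intro l js h _ _ _
        rw [htask, Nat.pair_eq_pair, encode_inj, encode_inj] at h
        obtain ⟨rfl, rfl⟩ := h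
        exact sat_select.2 hb
      · rw [ofFn_append_singleton, isolatedList_ofFn]
        exact hi
    · obtain ⟨b, -, hi⟩ := ha.exists_snoc hd (φ := ⊤) ⟨0, Formula.realize_top.2 trivial⟩
      refine ⟨List.ofFn a ++ [b], ⟨b, rfl, ?_⟩, by simp, ?_⟩
      · rintro l js h hl hj ⟨x, hx⟩
        obtain ⟨k, j, rfl⟩ := exists_eq_ofFn js
        rw [List.length_ofFn] at hl
        obtain ⟨φ, rfl⟩ := formN_iff.1 hl
        have hj' : ∀ i, j i < n := fun i => by
          simpa using hj (j i) (List.mem_ofFn.2 ⟨i, rfl⟩)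
        exact absurd ⟨k, φ, fun i => ⟨j i, hj' i⟩, h, x, (sat_select (g := g)
          (j := fun i => ⟨j i, hj' i⟩)).1 hx⟩ htask
      · rw [ofFn_append_singleton, isolatedList_ofFn]
        exact hi)
  let c : ℕ → ℕ := fun s => (f (s + 1)).getD s 0
  have hfc : ∀ s, f s = List.ofFn fun i : Fin s => c i := by
    intro s
    induction s with
    | zero => exact h₀
    | succ s ih =>
      obtain ⟨b, hb, -⟩ := (hs s).2
      have hc : c s = b := by
        simp only [c, hb]
        rw [List.getD_append_right _ _ _ _ (hs s).1.1.le, (hs s).1.1]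
        simp
      rw [hb, List.ofFn_succ', List.concat_eq_append, ih]
      simp [hc]
  refine ⟨c, by fun_prop, fun s => ?_, fun {k} φ j hx => ?_⟩
  · have := (hs s).1.2
    rwa [hfc, isolatedList_ofFn] at this
  · obtain ⟨m, hm⟩ := (Set.finite_range j).bddAbove
    obtain ⟨s, hst, hsm⟩ : ∃ s, (Nat.unpair s).1 = Nat.pair (encode (formToks g Fin.val φ))
        (encode (List.ofFn j)) ∧ m + 1 ≤ s :=
      ⟨Nat.pair _ (m + 1), by rw [Nat.unpair_pair], Nat.right_le_pair _ _⟩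
    have hj : ∀ i, j i < s := fun i => (Nat.lt_succ_of_le (hm ⟨i, rfl⟩)).trans_le hsm
    obtain ⟨b, hb, h⟩ := (hs s).2
    have hbc : b = c s := by
      have := congrArg (fun l => l.getD s 0) hb
      rw [List.getD_append_right _ _ _ _ (hs s).1.1.le, (hs s).1.1] at this
      simpa [c] using this.symm
    have hsel : ∀ x, Sat g (formToks g Fin.val φ)
        ((List.ofFn j).map (fun j => (f s).getD j 0) ++ [x]) ↔
          φ.Realize (Fin.snoc (fun i => c (j i)) x : Fin (k + 1) → ℕ) := by
      intro x
      rw [hfc s]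
      exact sat_select (j := fun i => ⟨j i, hj i⟩)
    have := h _ _ hst (by
      rw [List.length_ofFn]
      exact formN_iff.2 ⟨φ, rfl⟩) (fun i hi => by
      obtain ⟨i, rfl⟩ := List.mem_ofFn.1 hi
      rw [(hs s).1.1]
      exact hj i) (by simpa only [hsel] using hx)
    rw [hsel, hbc] at this
    exact ⟨s, this⟩

omit [L.Structure ℕ] in
/-- A complete theory transfers universally valid formulas between its models. -/
theorem realize_of_forall_realize {T : L.Theory} (hT : T.IsComplete) {M N : Type} [L.Structure M]
    [L.Structure N] [Nonempty M] [Nonempty N] (hM : ∀ φ ∈ T, Sentence.Realize M φ)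
    (hN : ∀ φ ∈ T, Sentence.Realize N φ) {k : ℕ} (φ : L.Formula (Fin k))
    (h : ∀ a : Fin k → M, φ.Realize a) (a : Fin k → N) : φ.Realize a := by
  have : M ⊨ T := ⟨fun {φ} hφ => hM φ hφ⟩
  have : N ⊨ T := ⟨fun {φ} hφ => hN φ hφ⟩
  let σ : L.Sentence := (φ.relabel (Sum.inr : Fin k → Empty ⊕ Fin k)).iAlls (Fin k)
  have hσ : ∀ (K : Type) [L.Structure K], Sentence.Realize K σ ↔ ∀ b : Fin k → K, φ.Realize b := by
    intro K _
    rw [Sentence.Realize, Formula.realize_iAlls]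
    simp only [Formula.realize_relabel]
    rfl
  exact (hσ N).1 ((hT.realize_sentence_iff σ N).2
    ((hT.realize_sentence_iff σ M).1 ((hσ M).2 h))) a

end Construction

/-- **Existence of an arithmetically decidable prime model** for arithmetically stable
theories. -/
theorem exists_arith_decidable_prime_model
    (L : FirstOrder.Language) (g : GoedelCoding L) (hL : ArithLang g)
    (T : L.Theory) (hT : ArithTheory g T) (hcomp : T.IsComplete)
    (hnf : NoFiniteModels L T)
    (hstab : ArithStable g T) :
    ∃ P : CodedStructure L, ArithDecidable g P ∧ PrimeModel L T P := by
  obtain ⟨N, SN, _, hN⟩ : ∃ (N : Type) (_ : L.Structure N), Infinite N ∧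
      ∀ φ ∈ T, Sentence.Realize N φ := by
    obtain ⟨N⟩ := hcomp.1
    exact ⟨N, inferInstance, hnf N _ fun φ hφ => N.is_model.realize_of_mem φ hφ,
      fun φ hφ => N.is_model.realize_of_mem φ hφ⟩
  obtain ⟨S, hS, hSat⟩ := exists_arith_model hL hT hN
  obtain ⟨c, hc, hac⟩ := exists_atomicSequence hL hSat
    fun φ hφ => exists_isolated hL hSat hS hstab φ hφ
  refine ⟨codedDoubles hac.toElementarySubstructure, arithDecidable_codedDoubles hL hSat _
    (Arith.congr (f := fun x => ∃ i, c i = x) (by fun_prop) fun x => rfl),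
    models_codedDoubles hS _, fun N SN hN => ?_⟩
  have : Infinite N := hnf N SN hN
  obtain ⟨j⟩ := hac.nonempty_elementaryEmbedding
    fun φ h a => realize_of_forall_realize hcomp hS hN φ h a
  exact ⟨j.comp (codedDoublesEquiv hac.toElementarySubstructure).symm.toElementaryEmbedding⟩

end ArMorley
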